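/- Let f : D^I_{p,q} → D^I_{p',q'} be a proper holomorphic map, where p ≥ q ≥ 2 and q' < p, and let f^† : D^I_{q,p} → D^I_{q',p'} be defined by f^†(Z) := (f(Zᵀ))ᵀ. Then f^† is fibral-image-preserving: for every (A,B) ∈ Ω_{q,p} there exists (C,D) ∈ Ω_{q',p'} such that C·f^†(Z) = D for every Z ∈ D^I_{q,p} with A·Z = B. Moreover, f^† has a local holomorphic moduli map: there exist a nonempty connected open subset U ⊆ Ω_{q,p} and a holomorphic map g = (g₁,g₂) : U → Ω_{q',p'} such that g₁(A,B)·f^†(Z) = g₂(A,B) for every (A,B) ∈ U and every Z ∈ D^I_{q,p} with A·Z = B. -/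

import Mathlib

open Matrix
open scoped ComplexOrder

attribute [local instance] Matrix.normedAddCommGroup Matrix.normedSpace

/-- The type-I irreducible bounded symmetric domain `D^I_{m,n}`,
realized as the set of complex `m × n` matrices `Z` with `I - Zᴴ Z` positive definite. -/
def typeIDomain (m n : ℕ) : Set (Matrix (Fin m) (Fin n) ℂ) :=
  {Z | (1 - Zᴴ * Z).PosDef}

/-- `f` maps `D` into `D'` and the `f`-preimage of every compact subset of `D'`
is a compact subset of `D`. -/
def ProperOn {E F : Type*} [TopologicalSpace E] [TopologicalSpace F]
    (f : E → F) (D : Set E) (D' : Set F) : Prop :=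
  Set.MapsTo f D D' ∧ ∀ K : Set F, K ⊆ D' → IsCompact K → IsCompact (D ∩ f ⁻¹' K)

/-- The affine cone over the generalized ball `D_{r,s} ⊂ ℙ^{r+s-1}`:
pairs of row vectors `(A,B)` with `‖A‖ > ‖B‖`. -/
def genBallCone (r s : ℕ) : Set ((Fin r → ℂ) × (Fin s → ℂ)) :=
  {x | ∑ j, ‖x.2 j‖ ^ 2 < ∑ i, ‖x.1 i‖ ^ 2}

/-- The transposed map `f^†(Z) := (f(Zᵀ))ᵀ`. -/
def dagger {p q p' q' : ℕ}
    (F : Matrix (Fin p) (Fin q) ℂ → Matrix (Fin p') (Fin q') ℂ)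
    (W : Matrix (Fin q) (Fin p) ℂ) : Matrix (Fin q') (Fin p') ℂ :=
  (F Wᵀ)ᵀ


section helpers
open Filter Topology Metric Set

/-- Schwarz–Pick inequality at the centre. -/
theorem schwarz_pick_aux {u : ℂ → ℂ} {ρ : ℝ} (hρ : 1 < ρ)
    (hd : DifferentiableOn ℂ u (ball 0 ρ)) (hm : ∀ s ∈ ball (0 : ℂ) ρ, ‖u s‖ < 1) :
    ‖u 1 - u 0‖ ≤ (1 / ρ) * ‖1 - (starRingEnd ℂ) (u 0) * u 1‖ := by
  have h0 : (0 : ℂ) ∈ ball (0 : ℂ) ρ := by simp; linarith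
  have h1 : (1 : ℂ) ∈ ball (0 : ℂ) ρ := by simpa using hρ
  have hne : ∀ s ∈ ball (0 : ℂ) ρ, 1 - (starRingEnd ℂ) (u 0) * u s ≠ 0 := by
    intro s hs h
    have h2 : (starRingEnd ℂ) (u 0) * u s = 1 := by linear_combination -h
    have h3 : ‖u 0‖ * ‖u s‖ = 1 := by
      have := congrArg norm h2
      simpa using this
    nlinarith [hm s hs, hm 0 h0, norm_nonneg (u 0), norm_nonneg (u s)]
  let g : ℂ → ℂ := fun s => (u s - u 0) / (1 - (starRingEnd ℂ) (u 0) * u s)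
  have hg : DifferentiableOn ℂ g (ball 0 ρ) := by
    apply DifferentiableOn.div
    · exact hd.sub_const _
    · exact (differentiableOn_const _).sub (hd.const_mul _)
    · exact hne
  have hg0 : g 0 = 0 := by simp [g]
  have key : ∀ a b : ℂ, ‖a‖ < 1 → ‖b‖ < 1 → ‖b - a‖ ^ 2 < ‖1 - (starRingEnd ℂ) a * b‖ ^ 2 := by
    intro a b ha hb
    have e1 : ‖1 - (starRingEnd ℂ) a * b‖ ^ 2 - ‖b - a‖ ^ 2 = (1 - ‖a‖ ^ 2) * (1 - ‖b‖ ^ 2) := by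
      simp only [← Complex.normSq_eq_norm_sq, Complex.normSq_apply]
      simp
      ring
    have : 0 < (1 - ‖a‖ ^ 2) * (1 - ‖b‖ ^ 2) := by
      apply mul_pos <;> nlinarith [norm_nonneg a, norm_nonneg b]
    linarith
  have hgm : MapsTo g (ball 0 ρ) (ball (g 0) 1) := by
    intro s hs
    rw [hg0, mem_ball_zero_iff]
    simp only [g, norm_div]
    rw [div_lt_one (norm_pos_iff.mpr (hne s hs))]
    exact lt_of_pow_lt_pow_left₀ 2 (norm_nonneg _) (key _ _ (hm 0 h0) (hm s hs))
  have h2 := Complex.dist_le_div_mul_dist_of_mapsTo_ball hg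
    (hgm.mono_right ball_subset_closedBall) h1
  rw [hg0, dist_zero_right, dist_zero_right, norm_one, mul_one] at h2
  simp only [g, norm_div] at h2
  rwa [div_le_iff₀ (norm_pos_iff.mpr (hne 1 h1))] at h2

theorem ultra_lim {α : Type*} [NormedAddCommGroup α] [ProperSpace α]
    (𝒰 : Ultrafilter ℕ) (u : ℕ → α) (R : ℝ) (h : ∀ k, ‖u k‖ ≤ R) :
    ∃ a, Tendsto u 𝒰 (𝓝 a) ∧ ‖a‖ ≤ R := by
  have hc : IsCompact (closedBall (0 : α) R) := isCompact_closedBall _ _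
  have := hc.ultrafilter_le_nhds (𝒰.map u) (by
    simp only [le_principal_iff]
    change u ⁻¹' (closedBall (0 : α) R) ∈ (𝒰 : Filter ℕ)
    exact Filter.mem_of_superset univ_mem (by intro k _; simpa using h k))
  obtain ⟨a, ha, hl⟩ := this
  exact ⟨a, hl, by simpa using ha⟩

set_option linter.unusedSectionVars false
set_option linter.unusedSimpArgs false

section abs
variable {E G G' : Type*} [NormedAddCommGroup E] [InnerProductSpace ℂ E] [FiniteDimensional ℂ E]
  [NormedAddCommGroup G] [InnerProductSpace ℂ G] [FiniteDimensional ℂ G]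
  [NormedAddCommGroup G'] [InnerProductSpace ℂ G'] [FiniteDimensional ℂ G']
  {n : ℕ}

/-- The determinant detecting whether a tuple of functionals of differences is independent. -/
noncomputable def mnr (f : (E →L[ℂ] G) → (EuclideanSpace ℂ (Fin n) →L[ℂ] G'))
    (l : Fin n → G' →L[ℂ] ℂ) (Z0 : E →L[ℂ] G) (Z : Fin n → E →L[ℂ] G) : ℂ :=
  Matrix.det (Matrix.of fun i k => l i ((f (Z i) - f Z0) (EuclideanSpace.single k 1)))

theorem mnr_diff (f : (E →L[ℂ] G) → (EuclideanSpace ℂ (Fin n) →L[ℂ] G'))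
    (hf : DifferentiableOn ℂ f (ball 0 1))
    (l : Fin n → G' →L[ℂ] ℂ) (Z0 : ℂ → E →L[ℂ] G) (Z : Fin n → ℂ → E →L[ℂ] G) (S : Set ℂ)
    (h0 : DifferentiableOn ℂ Z0 S) (h1 : ∀ i, DifferentiableOn ℂ (Z i) S)
    (hm0 : MapsTo Z0 S (ball 0 1)) (hm1 : ∀ i, MapsTo (Z i) S (ball 0 1)) :
    DifferentiableOn ℂ (fun s => mnr f l (Z0 s) (fun i => Z i s)) S := by
  have hc0 : DifferentiableOn ℂ (fun s => f (Z0 s)) S := hf.comp h0 hm0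
  have hc1 : ∀ i, DifferentiableOn ℂ (fun s => f (Z i s)) S := fun i => hf.comp (h1 i) (hm1 i)
  unfold mnr
  simp only [Matrix.det_apply]
  apply DifferentiableOn.fun_sum
  intro σ _
  apply DifferentiableOn.const_smul
  apply DifferentiableOn.fun_finsetProd
  intro i _
  simp only [Matrix.of_apply]
  refine (l (σ i)).differentiable.comp_differentiableOn (f := fun x => (f (Z (σ i) x) - f (Z0 x)) (EuclideanSpace.single i 1)) ?_
  exact ((hc1 _).sub hc0).clm_apply (differentiableOn_const _)

theorem norm_attained (H : EuclideanSpace ℂ (Fin n) →L[ℂ] G') (hH : ‖H‖ = 1) :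
    ∃ C, ‖C‖ = 1 ∧ ‖H C‖ = 1 := by
  have hne : (sphere (0 : EuclideanSpace ℂ (Fin n)) 1).Nonempty := by
    by_contra hcon
    have : ∀ x : EuclideanSpace ℂ (Fin n), x = 0 := by
      intro x
      by_contra hx
      apply hcon
      refine ⟨((‖x‖⁻¹ : ℝ) : ℂ) • x, ?_⟩
      simp [norm_smul, hx]
    have h0 : H = 0 := by ext x; rw [this x]; simp
    rw [h0] at hH; simp at hH
  obtain ⟨C, hC, hmax⟩ := (isCompact_sphere (0 : EuclideanSpace ℂ (Fin n)) 1).exists_isMaxOn hne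
    (f := fun x => ‖H x‖) (by fun_prop)
  have hC1 : ‖C‖ = 1 := by simpa using hC
  refine ⟨C, hC1, le_antisymm ?_ ?_⟩
  · simpa [hC1, hH] using H.le_opNorm C
  · rw [← hH]
    apply H.opNorm_le_bound (norm_nonneg _)
    intro x
    by_cases hx : x = 0
    · simp [hx]
    · have := hmax (show ((‖x‖⁻¹ : ℝ) : ℂ) • x ∈ sphere 0 1 by simp [norm_smul, hx])
      simp only [mem_ofPred_eq, map_smul, norm_smul] at this
      simp at this
      rwa [inv_mul_le_iff₀ (norm_pos_iff.mpr hx), mul_comm] at this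

/-- Norm estimate for block-diagonal operators. -/
theorem block_norm (A : E) (v : G) (hA : ‖A‖ = 1) (hv : ‖v‖ = 1) (X : E →L[ℂ] G)
    (hXA : X A = 0) (hvX : ∀ x, inner ℂ v (X x) = 0) (t : ℂ) (r : ℝ) (hr : 0 ≤ r)
    (ht : ‖t‖ ≤ r) (hX : ‖X‖ ≤ r) :
    ‖t • (innerSL ℂ A).smulRight v + X‖ ≤ r := by
  apply ContinuousLinearMap.opNorm_le_bound _ hr
  intro x
  set α := inner ℂ A x with hα
  set y := x - α • A with hy
  have hAy : inner ℂ A y = 0 := by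
    simp [hy, inner_sub_right, inner_smul_right, inner_self_eq_norm_sq_to_K, hA, hα]
  have hx : x = α • A + y := by simp [hy]
  have hXx : X x = X y := by rw [hx]; simp [hXA]
  have n1 : ‖x‖ ^ 2 = ‖α‖ ^ 2 + ‖y‖ ^ 2 := by
    have := norm_add_sq_eq_norm_sq_add_norm_sq_of_inner_eq_zero (𝕜 := ℂ) (α • A) y
      (by simp [inner_smul_left, hAy])
    rw [← hx, norm_smul, hA] at this
    nlinarith
  have n2 : ‖(t • (innerSL ℂ A).smulRight v + X) x‖ ^ 2 = (‖t‖ * ‖α‖) ^ 2 + ‖X y‖ ^ 2 := by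
    have e : (t • (innerSL ℂ A).smulRight v + X) x = (t * α) • v + X y := by
      simp [hXx, smul_smul, hα]
    have := norm_add_sq_eq_norm_sq_add_norm_sq_of_inner_eq_zero (𝕜 := ℂ) ((t * α) • v) (X y)
      (by simp [inner_smul_left, hvX])
    rw [e, ]
    rw [norm_smul, hv, norm_mul] at this
    nlinarith
  have hXy : ‖X y‖ ≤ r * ‖y‖ := (X.le_opNorm y).trans (by gcongr)
  apply le_of_sq_le_sq _ (by positivity)
  rw [n2, mul_pow r, n1, mul_add, ← mul_pow, ← mul_pow]
  gcongr

theorem block_norm_X (A : E) (v : G) (hA : ‖A‖ = 1) (hv : ‖v‖ = 1) (X : E →L[ℂ] G)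
    (hXA : X A = 0) (hvX : ∀ x, inner ℂ v (X x) = 0) (t : ℂ) :
    ‖t‖ ≤ ‖t • (innerSL ℂ A).smulRight v + X‖ ∧ ‖X‖ ≤ ‖t • (innerSL ℂ A).smulRight v + X‖ := by
  constructor
  · have := (t • (innerSL ℂ A).smulRight v + X).le_opNorm A
    have e : (t • (innerSL ℂ A).smulRight v + X) A = t • v := by
      simp [hXA, inner_self_eq_norm_sq_to_K, hA]
    rwa [e, norm_smul, hv, hA, mul_one, mul_one] at this
  · apply ContinuousLinearMap.opNorm_le_bound _ (norm_nonneg _)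
    intro x
    refine le_trans ?_ ((t • (innerSL ℂ A).smulRight v + X).le_opNorm x)
    apply le_of_sq_le_sq _ (norm_nonneg _)
    have e : (t • (innerSL ℂ A).smulRight v + X) x = (t * inner ℂ A x) • v + X x := by
      simp [smul_smul]
    have := norm_add_sq_eq_norm_sq_add_norm_sq_of_inner_eq_zero (𝕜 := ℂ) ((t * inner ℂ A x) • v) (X x)
      (by simp [inner_smul_left, hvX])
    rw [e]
    nlinarith [norm_nonneg ((t * inner ℂ A x) • v)]
end abs

open Filter Topology Metric Set
section abs
variable {E G G' : Type*} [NormedAddCommGroup E] [InnerProductSpace ℂ E] [FiniteDimensional ℂ E]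
  [NormedAddCommGroup G] [InnerProductSpace ℂ G] [FiniteDimensional ℂ G]
  [NormedAddCommGroup G'] [InnerProductSpace ℂ G'] [FiniteDimensional ℂ G']
  {n : ℕ}

theorem tendsto_app {ι : Type*} {lf : Filter ι} {V W : Type*} [NormedAddCommGroup V]
    [NormedSpace ℂ V] [NormedAddCommGroup W] [NormedSpace ℂ W] {T : ι → V →L[ℂ] W} {S : V →L[ℂ] W}
    (h : Tendsto T lf (𝓝 S)) (x : V) : Tendsto (fun k => T k x) lf (𝓝 (S x)) :=
  ((ContinuousLinearMap.apply ℂ W x).continuous.tendsto S).comp h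

/-- The vanishing of all minors along an orthogonal block family. -/
theorem special_unit (f : (E →L[ℂ] G) → (EuclideanSpace ℂ (Fin n) →L[ℂ] G'))
    (hf : DifferentiableOn ℂ f (ball 0 1)) (hfm : MapsTo f (ball 0 1) (ball 0 1))
    (hfp : ∀ r < 1, IsCompact (ball 0 1 ∩ f ⁻¹' (closedBall 0 r)))
    (l : Fin n → G' →L[ℂ] ℂ) (A : E) (v : G) (hA : ‖A‖ = 1) (hv : ‖v‖ = 1) (t : ℂ)
    (X0 : E →L[ℂ] G) (X : Fin n → E →L[ℂ] G) (hX0A : X0 A = 0) (hvX0 : ∀ x, inner ℂ v (X0 x) = 0)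
    (hXA : ∀ i, X i A = 0) (hvX : ∀ i x, inner ℂ v (X i x) = 0)
    (hD0 : ‖t • (innerSL ℂ A).smulRight v + X0‖ < 1)
    (hD : ∀ i, ‖t • (innerSL ℂ A).smulRight v + X i‖ < 1) :
    mnr f l (t • (innerSL ℂ A).smulRight v + X0) (fun i => t • (innerSL ℂ A).smulRight v + X i)
      = 0 := by
  set K : E →L[ℂ] G := (innerSL ℂ A).smulRight v with hK
  have ht : ‖t‖ < 1 := (block_norm_X A v hA hv X0 hX0A hvX0 t).1.trans_lt hD0
  have hXn0 : ‖X0‖ < 1 := (block_norm_X A v hA hv X0 hX0A hvX0 t).2.trans_lt hD0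
  have hXn : ∀ i, ‖X i‖ < 1 := fun i =>
    (block_norm_X A v hA hv (X i) (hXA i) (hvX i) t).2.trans_lt (hD i)
  -- block operators stay in the unit ball
  have hin : ∀ (Y : E →L[ℂ] G), Y A = 0 → (∀ x, inner ℂ v (Y x) = 0) → ‖Y‖ < 1 →
      ∀ τ : ℂ, ‖τ‖ < 1 → τ • K + Y ∈ ball (0 : E →L[ℂ] G) 1 := by
    intro Y h1 h2 h3 τ hτ
    rw [mem_ball_zero_iff]
    exact (block_norm A v hA hv Y h1 h2 τ (max ‖τ‖ ‖Y‖) (by positivity) (le_max_left _ _)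
      (le_max_right _ _)).trans_lt (max_lt hτ h3)
  by_contra hne
  set δ : ℂ → ℂ := fun τ => mnr f l (τ • K + X0) (fun i => τ • K + X i) with hδ
  have hδd : DifferentiableOn ℂ δ (ball 0 1) := by
    apply mnr_diff f hf l (fun τ => τ • K + X0) (fun i τ => τ • K + X i) (ball 0 1)
    · fun_prop
    · intro i; fun_prop
    · intro τ hτ; exact hin X0 hX0A hvX0 hXn0 τ (by simpa using hτ)
    · intro i τ hτ; exact hin (X i) (hXA i) (hvX i) (hXn i) τ (by simpa using hτ)
  have hpos : 0 < ‖δ t‖ := norm_pos_iff.mpr hne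
  -- maximum principle
  have hmax : ∀ r : ℝ, ‖t‖ < r → r < 1 → ∃ τ : ℂ, ‖τ‖ = r ∧ ‖δ t‖ ≤ ‖δ τ‖ := by
    intro r hr1 hr2
    have hr0 : 0 < r := (norm_nonneg t).trans_lt hr1
    have hdc : DiffContOnCl ℂ δ (ball 0 r) := by
      apply DifferentiableOn.diffContOnCl
      rw [closure_ball _ hr0.ne']
      exact hδd.mono (closedBall_subset_ball hr2)
    obtain ⟨τ, hτ, hm⟩ := Complex.exists_mem_frontier_isMaxOn_norm isBounded_ball
      (nonempty_ball.mpr hr0) hdc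
    rw [frontier_ball _ hr0.ne'] at hτ
    refine ⟨τ, by simpa using hτ, hm ?_⟩
    rw [closure_ball _ hr0.ne']
    simpa using hr1.le
  have hseq : ∀ k : ℕ, ∃ τ : ℂ, ‖τ‖ = 1 - (1 - ‖t‖) / (k + 2) ∧ ‖δ t‖ ≤ ‖δ τ‖ := by
    intro k
    have hk : (0 : ℝ) < (k : ℝ) + 2 := by positivity
    have h1t : 0 < 1 - ‖t‖ := by linarith
    apply hmax
    · have : (1 - ‖t‖) / (k + 2) < 1 - ‖t‖ := by
        apply div_lt_self h1t
        have : (0 : ℝ) ≤ k := by positivity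
        linarith
      linarith
    · have : 0 < (1 - ‖t‖) / (k + 2) := by positivity
      linarith
  choose τ hτn hτd using hseq
  have hτ1 : ∀ k, ‖τ k‖ < 1 := by
    intro k
    rw [hτn]
    have h1t : 0 < 1 - ‖t‖ := by linarith
    have : 0 < (1 - ‖t‖) / (k + 2) := by positivity
    linarith
  have hτlim : Tendsto (fun k => ‖τ k‖) atTop (𝓝 1) := by
    simp only [hτn]
    have h2 : Tendsto (fun k : ℕ => (k : ℝ) + 2) atTop atTop :=
      tendsto_atTop_add_const_right _ _ tendsto_natCast_atTop_atTop
    have h3 : Tendsto (fun k : ℕ => (1 - ‖t‖) / ((k : ℝ) + 2)) atTop (𝓝 0) :=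
      h2.const_div_atTop _
    simpa using h3.const_sub 1
  let 𝒰 : Ultrafilter ℕ := hyperfilter ℕ
  have h𝒰 : (𝒰 : Filter ℕ) ≤ atTop := by
    rw [← Nat.cofinite_eq_atTop]; exact hyperfilter_le_cofinite
  have hlim : ∀ Y : E →L[ℂ] G, Y A = 0 → (∀ x, inner ℂ v (Y x) = 0) → ‖Y‖ < 1 →
      ∃ H, Tendsto (fun k => f (τ k • K + Y)) 𝒰 (𝓝 H) ∧ ‖H‖ ≤ 1 := by
    intro Y h1 h2 h3
    apply ultra_lim
    intro k
    have := hfm (hin Y h1 h2 h3 (τ k) (hτ1 k))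
    rw [mem_ball_zero_iff] at this
    exact this.le
  obtain ⟨τs, hτs, -⟩ := ultra_lim 𝒰 τ 1 (fun k => (hτ1 k).le)
  have hτs1 : ‖τs‖ = 1 :=
    tendsto_nhds_unique (hτs.norm) (hτlim.mono_left h𝒰)
  obtain ⟨H, hH, hH1⟩ := hlim 0 (by simp) (by simp) (by simp)
  have hHn : ‖H‖ = 1 := by
    by_contra hcon
    have hlt : ‖H‖ < 1 := lt_of_le_of_ne hH1 hcon
    obtain ⟨r, hr1, hr2⟩ := exists_between hlt
    have hcl := (hfp r hr2).isClosed
    have hmem : ∀ᶠ k in (𝒰 : Filter ℕ), τ k • K + 0 ∈ ball (0 : E →L[ℂ] G) 1 ∩ f ⁻¹' (closedBall 0 r) := by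
      filter_upwards [hH.norm.eventually_lt_const hr1] with k hk
      exact ⟨hin 0 (by simp) (by simp) (by simp) (τ k) (hτ1 k), by simpa using hk.le⟩
    have hl2 : Tendsto (fun k => τ k • K + 0) 𝒰 (𝓝 (τs • K + 0)) :=
      (hτs.smul_const K).add_const 0
    have h3 := hcl.mem_of_tendsto hl2 hmem
    have h4 : ‖τs • K + 0‖ < 1 := by simpa using h3.1
    have h5 := (block_norm_X A v hA hv (0 : E →L[ℂ] G) (by simp) (by simp) τs).1
    rw [← hK] at h5
    linarith
  obtain ⟨C, hC, hHC⟩ := norm_attained H hHn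
  have hkey : ∀ (Y : E →L[ℂ] G), Y A = 0 → (∀ x, inner ℂ v (Y x) = 0) → ‖Y‖ < 1 →
      ∀ H', Tendsto (fun k => f (τ k • K + Y)) 𝒰 (𝓝 H') → ‖H'‖ ≤ 1 → H' C = H C := by
    intro Y h1 h2 h3 H' hH' hH'1
    obtain ⟨ρ, hρ1, hρ2⟩ : ∃ ρ : ℝ, 1 < ρ ∧ ρ * ‖Y‖ < 1 := by
      by_cases hY : ‖Y‖ = 0
      · exact ⟨2, by norm_num, by rw [hY]; norm_num⟩
      · have hYp : 0 < ‖Y‖ := lt_of_le_of_ne (norm_nonneg _) (Ne.symm hY)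
        obtain ⟨ρ, a, b⟩ := exists_between ((one_lt_inv₀ hYp).mpr h3)
        refine ⟨ρ, a, ?_⟩
        rwa [lt_inv_comm₀ (by linarith) hYp, ← one_div, lt_div_iff₀ (by linarith), mul_comm] at b
    have hsin : ∀ k, ∀ s ∈ ball (0 : ℂ) ρ, τ k • K + s • Y ∈ ball (0 : E →L[ℂ] G) 1 := by
      intro k s hs
      apply hin (s • Y) (by simp [h1]) (by simp [inner_smul_right, h2]) _ _ (hτ1 k)
      rw [norm_smul]
      have : ‖s‖ < ρ := by simpa using hs
      nlinarith [norm_nonneg Y]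
    have hsp : ∀ k, ‖inner ℂ (H C) (f (τ k • K + Y) C) - inner ℂ (H C) (f (τ k • K + 0) C)‖ ≤
        (1 / ρ) * ‖1 - (starRingEnd ℂ) (inner ℂ (H C) (f (τ k • K + 0) C)) *
          inner ℂ (H C) (f (τ k • K + Y) C)‖ := by
      intro k
      have := schwarz_pick_aux (u := fun s => inner ℂ (H C) (f (τ k • K + s • Y) C)) hρ1 ?_ ?_
      · simpa using this
      · refine (innerSL ℂ (H C)).differentiable.comp_differentiableOn
          (f := fun s => f (τ k • K + s • Y) C) ?_
        refine DifferentiableOn.clm_apply ?_ (differentiableOn_const _)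
        refine hf.comp (f := fun s : ℂ => τ k • K + s • Y) ?_ (hsin k)
        fun_prop
      · intro s hs
        have h4 := hfm (hsin k s hs)
        rw [mem_ball_zero_iff] at h4
        calc _ ≤ ‖H C‖ * ‖f (τ k • K + s • Y) C‖ := norm_inner_le_norm _ _
          _ ≤ 1 * (‖f (τ k • K + s • Y)‖ * ‖C‖) := by
            rw [hHC]; gcongr; exact ContinuousLinearMap.le_opNorm _ _
          _ < 1 := by rw [hC]; simpa using h4
    have l1 : Tendsto (fun k => inner ℂ (H C) (f (τ k • K + Y) C)) 𝒰 (𝓝 (inner ℂ (H C) (H' C))) :=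
      tendsto_const_nhds.inner (tendsto_app hH' C)
    have l0 : Tendsto (fun k => inner ℂ (H C) (f (τ k • K + 0) C)) 𝒰 (𝓝 (inner ℂ (H C) (H C))) :=
      tendsto_const_nhds.inner (tendsto_app hH C)
    have e1 : inner ℂ (H C) (H C) = (1 : ℂ) := by
      rw [inner_self_eq_norm_sq_to_K, hHC]; simp
    rw [e1] at l0
    have hle := le_of_tendsto_of_tendsto (l1.sub l0).norm
      ((((tendsto_const_nhds (x := (1 : ℂ))).sub
        (((Complex.continuous_conj.tendsto _).comp l0).mul l1)).norm).const_mul (1 / ρ))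
      (Eventually.of_forall hsp)
    simp only [map_one, one_mul] at hle
    rw [norm_sub_rev (1 : ℂ)] at hle
    have hz : inner ℂ (H C) (H' C) = (1 : ℂ) := by
      have : 1 / ρ < 1 := by rw [div_lt_one (by linarith)]; exact hρ1
      have : ‖inner ℂ (H C) (H' C) - 1‖ = (0 : ℝ) := by
        nlinarith [norm_nonneg (inner ℂ (H C) (H' C) - 1)]
      exact sub_eq_zero.mp (norm_eq_zero.mp this)
    have hn : ‖H' C‖ ≤ 1 := by
      have := H'.le_opNorm C
      rw [hC, mul_one] at this
      linarith
    have hn' : ‖H' C‖ = 1 := by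
      apply le_antisymm hn
      have := norm_inner_le_norm (𝕜 := ℂ) (H C) (H' C)
      rwa [hz, hHC, norm_one, one_mul] at this
    exact ((inner_eq_one_iff_of_norm_eq_one hHC hn').mp hz).symm
  obtain ⟨H0, hH0, hH01⟩ := hlim X0 hX0A hvX0 hXn0
  choose Hi hHi hHi1 using fun i => hlim (X i) (hXA i) (hvX i) (hXn i)
  have hδlim : Tendsto (fun k => δ (τ k)) 𝒰 (𝓝 (Matrix.det (Matrix.of fun i k => l i ((Hi i - H0) (EuclideanSpace.single k 1))))) := by
    simp only [hδ, mnr]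
    refine ((Continuous.matrix_det continuous_id).tendsto _).comp ?_
    refine tendsto_pi_nhds.mpr fun i => tendsto_pi_nhds.mpr fun k => ?_
    exact ((l i).continuous.tendsto _).comp (tendsto_app ((hHi i).sub hH0) _)
  have hdet : Matrix.det (Matrix.of fun i k => l i ((Hi i - H0) (EuclideanSpace.single k 1))) = 0 := by
    rw [← Matrix.exists_mulVec_eq_zero_iff]
    refine ⟨C, ?_, ?_⟩
    · intro h0
      have : C = 0 := by ext i; exact congrFun h0 i
      rw [this] at hC; simp at hC
    · ext i
      have hC2 : C = ∑ k, C k • EuclideanSpace.single k (1 : ℂ) := by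
        ext j; simp [Pi.single_apply]
      have : l i ((Hi i - H0) C) = 0 := by
        simp [hkey _ (hXA i) (hvX i) (hXn i) _ (hHi i) (hHi1 i), hkey _ hX0A hvX0 hXn0 _ hH0 hH01]
      rw [hC2, map_sum, map_sum] at this
      simp only [map_smul, smul_eq_mul] at this
      simp only [Matrix.mulVec, dotProduct, Matrix.of_apply, Pi.zero_apply]
      rw [← this]
      exact Finset.sum_congr rfl fun k _ => mul_comm _ _
  rw [hdet] at hδlim
  have := ge_of_tendsto (hδlim.norm) (Eventually.of_forall hτd)
  rw [norm_zero] at this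
  linarith

theorem ident_line {g : ℂ → ℂ} (hg : DifferentiableOn ℂ g (ball 0 1))
    (h : ∀ σ ∈ ball (0 : ℂ) 1, σ.re = 1 / 2 → g σ = 0) : g 0 = 0 := by
  have ha : AnalyticOnNhd ℂ g (ball 0 1) := hg.analyticOnNhd isOpen_ball
  have hz : AnalyticOnNhd ℂ (fun _ : ℂ => (0 : ℂ)) (ball 0 1) := analyticOnNhd_const
  have hmem : (1 / 2 : ℂ) ∈ ball (0 : ℂ) 1 := by simp; norm_num
  have hseq : Tendsto (fun k : ℕ => (1 / 2 : ℂ) + (((1 / ((k : ℝ) + 1) : ℝ)) : ℂ) * Complex.I) atTop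
      (𝓝 (1 / 2)) := by
    have h1 : Tendsto (fun k : ℕ => (1 / ((k : ℝ) + 1) : ℝ)) atTop (𝓝 0) :=
      tendsto_one_div_add_atTop_nhds_zero_nat
    have h2 := ((Complex.continuous_ofReal.tendsto 0).comp h1).mul_const Complex.I
    simpa using h2.const_add (1 / 2 : ℂ)
  have hseq' : Tendsto (fun k : ℕ => (1 / 2 : ℂ) + (((1 / ((k : ℝ) + 1) : ℝ)) : ℂ) * Complex.I) atTop
      (𝓝[≠] (1 / 2)) := by
    rw [tendsto_nhdsWithin_iff]
    refine ⟨hseq, Eventually.of_forall fun k => ?_⟩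
    simp only [mem_compl_iff, mem_singleton_iff, add_eq_left, mul_eq_zero, Complex.I_ne_zero, or_false]
    rw [Complex.ofReal_eq_zero]
    positivity
  have hfr : ∃ᶠ z in 𝓝[≠] (1 / 2 : ℂ), g z = (fun _ : ℂ => (0 : ℂ)) z := by
    apply hseq'.frequently
    apply Eventually.frequently
    filter_upwards [hseq.eventually (isOpen_ball.mem_nhds hmem)] with k hk
    exact h _ hk (by simp)
  exact ha.eqOn_of_preconnected_of_frequently_eq hz (convex_ball _ _).isPreconnected hmem hfr
    (mem_ball_self one_pos)

theorem ident_seg {g : ℂ → ℂ} {S : Set ℂ} (hS : IsOpen S) (hc : Convex ℝ S) (h0 : (0 : ℂ) ∈ S)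
    (h1 : (1 : ℂ) ∈ S) (hg : DifferentiableOn ℂ g S)
    (h : ∀ᶠ μ : ℝ in 𝓝 0, g (μ : ℂ) = 0) : g 1 = 0 := by
  have ha : AnalyticOnNhd ℂ g S := hg.analyticOnNhd hS
  have hz : AnalyticOnNhd ℂ (fun _ : ℂ => (0 : ℂ)) S := analyticOnNhd_const
  have hseq : Tendsto (fun k : ℕ => (1 / ((k : ℝ) + 1) : ℝ)) atTop (𝓝 0) :=
    tendsto_one_div_add_atTop_nhds_zero_nat
  have hseq' : Tendsto (fun k : ℕ => (((1 / ((k : ℝ) + 1) : ℝ)) : ℂ)) atTop (𝓝[≠] 0) := by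
    rw [tendsto_nhdsWithin_iff]
    refine ⟨?_, Eventually.of_forall fun k => ?_⟩
    · have := (Complex.continuous_ofReal.tendsto 0).comp hseq
      rw [Complex.ofReal_zero] at this
      exact this
    simp only [mem_compl_iff, mem_singleton_iff]
    rw [Complex.ofReal_eq_zero]
    positivity
  have hfr : ∃ᶠ z in 𝓝[≠] (0 : ℂ), g z = (fun _ : ℂ => (0 : ℂ)) z := by
    apply hseq'.frequently
    apply Eventually.frequently
    exact hseq.eventually h
  exact ha.eqOn_of_preconnected_of_frequently_eq hz hc.isPreconnected h0 hfr h1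

theorem special_gen (f : (E →L[ℂ] G) → (EuclideanSpace ℂ (Fin n) →L[ℂ] G'))
    (hf : DifferentiableOn ℂ f (ball 0 1)) (hfm : MapsTo f (ball 0 1) (ball 0 1))
    (hfp : ∀ r < 1, IsCompact (ball 0 1 ∩ f ⁻¹' (closedBall 0 r)))
    (l : Fin n → G' →L[ℂ] ℂ) (A : E) (v : G) (hA : A ≠ 0) (hv : v ≠ 0) (t : ℂ)
    (X0 : E →L[ℂ] G) (X : Fin n → E →L[ℂ] G) (hX0A : X0 A = 0) (hvX0 : ∀ x, inner ℂ v (X0 x) = 0)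
    (hXA : ∀ i, X i A = 0) (hvX : ∀ i x, inner ℂ v (X i x) = 0)
    (hD0 : ‖t • (innerSL ℂ A).smulRight v + X0‖ < 1)
    (hD : ∀ i, ‖t • (innerSL ℂ A).smulRight v + X i‖ < 1) :
    mnr f l (t • (innerSL ℂ A).smulRight v + X0) (fun i => t • (innerSL ℂ A).smulRight v + X i)
      = 0 := by
  have hA' : ((‖A‖ : ℝ) : ℂ) ≠ 0 := by simpa using hA
  have hv' : ((‖v‖ : ℝ) : ℂ) ≠ 0 := by simpa using hv
  set A1 : E := ((‖A‖ : ℝ) : ℂ)⁻¹ • A with hA1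
  set v1 : G := ((‖v‖ : ℝ) : ℂ)⁻¹ • v with hv1
  have e : t • (innerSL ℂ A).smulRight v =
      (t * (‖A‖ : ℝ) * (‖v‖ : ℝ)) • (innerSL ℂ A1).smulRight v1 := by
    ext x
    simp only [hA1, hv1, _root_.smul_apply, ContinuousLinearMap.smulRight_apply,
      innerSL_apply_apply, inner_smul_left, smul_smul, map_inv₀, Complex.conj_ofReal]
    congr 1
    field_simp
  rw [e] at hD0 ⊢
  simp only [e] at hD
  apply special_unit f hf hfm hfp l A1 v1 _ _ _ X0 X _ _ _ _ hD0 hD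
  · simp [hA1, norm_smul, hA]
  · simp [hv1, norm_smul, hv]
  · simp [hA1, hX0A]
  · intro x; simp [hv1, inner_smul_left, hvX0]
  · intro i; simp [hA1, hXA]
  · intro i x; simp [hv1, inner_smul_left, hvX]

/-- The polarized family. -/
noncomputable def polFam (p1 a' : E →L[ℂ] ℂ) (v' : G →L[ℂ] ℂ) (v w : G) (A : E) (t κ : ℂ)
    (Y : E →L[ℂ] G) : E →L[ℂ] G :=
  t • a'.smulRight v + κ⁻¹ • (((v' v) • ContinuousLinearMap.id ℂ G - v'.smulRight v) ∘L
    ((Y - t • p1.smulRight w) ∘L ((a' A) • ContinuousLinearMap.id ℂ E - a'.smulRight A)))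

theorem polFam_A (p1 a' : E →L[ℂ] ℂ) (v' : G →L[ℂ] ℂ) (v w : G) (A : E) (t κ : ℂ)
    (Y : E →L[ℂ] G) : (polFam p1 a' v' v w A t κ Y - t • a'.smulRight v) A = 0 := by
  unfold polFam
  rw [add_sub_cancel_left]
  simp only [_root_.smul_apply, ContinuousLinearMap.comp_apply, _root_.sub_apply (f := (a' A) • ContinuousLinearMap.id ℂ E),
    ContinuousLinearMap.id_apply, ContinuousLinearMap.smulRight_apply, sub_self, map_zero, smul_zero]

theorem polFam_v (p1 a' : E →L[ℂ] ℂ) (v' : G →L[ℂ] ℂ) (v w : G) (A : E) (t κ : ℂ)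
    (Y : E →L[ℂ] G) (x : E) : v' ((polFam p1 a' v' v w A t κ Y - t • a'.smulRight v) x) = 0 := by
  unfold polFam
  rw [add_sub_cancel_left]
  simp only [_root_.smul_apply, ContinuousLinearMap.comp_apply, map_smul]
  generalize (Y - t • p1.smulRight w) _ = y
  simp [mul_comm]

theorem sr_cont {α V W : Type*} [TopologicalSpace α] [NormedAddCommGroup V] [NormedSpace ℂ V]
    [NormedAddCommGroup W] [NormedSpace ℂ W] {a : α → V →L[ℂ] ℂ} {w : α → W} (ha : Continuous a)
    (hw : Continuous w) : Continuous fun z => (a z).smulRight (w z) :=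
  ((ContinuousLinearMap.smulRightL ℂ V W).continuous.comp ha).clm_apply hw

theorem sr_diff {V W : Type*} [NormedAddCommGroup V] [NormedSpace ℂ V]
    [NormedAddCommGroup W] [NormedSpace ℂ W] {a : ℂ → V →L[ℂ] ℂ} {w : ℂ → W}
    (ha : Differentiable ℂ a) (hw : Differentiable ℂ w) :
    Differentiable ℂ fun z => (a z).smulRight (w z) :=
  Differentiable.clm_apply (c := fun z => ContinuousLinearMap.smulRightL ℂ V W (a z))
    ((ContinuousLinearMap.smulRightL ℂ V W).differentiable.comp ha) hw

set_option maxHeartbeats 1000000 in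
theorem near_polar (f : (E →L[ℂ] G) → (EuclideanSpace ℂ (Fin n) →L[ℂ] G'))
    (hf : DifferentiableOn ℂ f (ball 0 1)) (hfm : MapsTo f (ball 0 1) (ball 0 1))
    (hfp : ∀ r < 1, IsCompact (ball 0 1 ∩ f ⁻¹' (closedBall 0 r)))
    (l : Fin n → G' →L[ℂ] ℂ) (A0 : E) (v0 : G) (hA : ‖A0‖ = 1) (hv : ‖v0‖ = 1)
    (Y0 : E →L[ℂ] G) (Y : Fin n → E →L[ℂ] G) (hYA : ∀ i, Y i A0 = Y0 A0)
    (hvY : ∀ i x, inner ℂ v0 (Y i x) = inner ℂ v0 (Y0 x)) :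
    ∀ᶠ μ : ℝ in 𝓝 0, mnr f l ((1 / 2 : ℂ) • (innerSL ℂ A0).smulRight v0 + (μ : ℂ) • Y0)
      (fun i => (1 / 2 : ℂ) • (innerSL ℂ A0).smulRight v0 + (μ : ℂ) • Y i) = 0 := by
  set Zs : E →L[ℂ] G := (1 / 2 : ℂ) • (innerSL ℂ A0).smulRight v0 with hZs
  set b : G := Y0 A0 with hb
  set γ : E := ContinuousLinearMap.adjoint Y0 v0 with hγ
  have hγx : ∀ x, inner ℂ γ x = inner ℂ v0 (Y0 x) := fun x => by
    rw [hγ, ContinuousLinearMap.adjoint_inner_left]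
  set τ1 : ℂ := inner ℂ v0 b with hτ1
  have hτ1' : inner ℂ γ A0 = τ1 := by rw [hγx]
  have hAA : inner ℂ A0 A0 = (1 : ℂ) := by rw [inner_self_eq_norm_sq_to_K, hA]; simp
  have hvv : inner ℂ v0 v0 = (1 : ℂ) := by rw [inner_self_eq_norm_sq_to_K, hv]; simp
  let vv : ℝ → ℂ → G := fun μ σ => v0 + ((1 - σ) * (2 * (μ : ℂ))) • b
  let vp : ℝ → ℂ → G →L[ℂ] ℂ := fun μ σ => innerSL ℂ v0 + (σ * (2 * (μ : ℂ))) • innerSL ℂ b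
  let AA : ℝ → ℂ → E := fun μ σ => A0 + (σ * (2 * (μ : ℂ))) • γ
  let Ap : ℝ → ℂ → E →L[ℂ] ℂ := fun μ σ => innerSL ℂ A0 + ((1 - σ) * (2 * (μ : ℂ))) • innerSL ℂ γ
  let m : ℝ → ℂ := fun μ => 1 + 2 * (μ : ℂ) * τ1
  let t : ℝ → ℂ := fun μ => (2 * m μ)⁻¹
  let Φ : (E →L[ℂ] G) → ℝ → ℂ → E →L[ℂ] G := fun Y μ σ =>
    polFam (Ap μ 0) (Ap μ σ) (vp μ σ) (vv μ σ) (vv μ 0) (AA μ σ) (t μ) (m μ * m μ) (Zs + (μ : ℂ) • Y)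
  -- continuity and the value at `μ = 0`
  have hm0 : m 0 = 1 := by simp [m]
  have hΦ0 : ∀ W σ, Φ W 0 σ = Zs := by
    intro W σ
    ext x
    simp [Φ, polFam, vv, Ap, t, hm0, hZs]
  have hΦc : ∀ W σ, ContinuousAt (fun z : ℝ × ℂ => Φ W z.1 z.2) (0, σ) := by
    intro W σ
    have ht : ContinuousAt (fun z : ℝ × ℂ => t z.1) (0, σ) := by
      apply ContinuousAt.inv₀
      · fun_prop
      · simp [m]
    have hk : ContinuousAt (fun z : ℝ × ℂ => (m z.1 * m z.1)⁻¹) (0, σ) := by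
      apply ContinuousAt.inv₀
      · fun_prop
      · simp [m]
    have c1 : Continuous fun z : ℝ × ℂ => Ap z.1 z.2 := by fun_prop
    have c2 : Continuous fun z : ℝ × ℂ => vp z.1 z.2 := by fun_prop
    have c3 : Continuous fun z : ℝ × ℂ => vv z.1 z.2 := by fun_prop
    have c4 : Continuous fun z : ℝ × ℂ => AA z.1 z.2 := by fun_prop
    have c5 : Continuous fun z : ℝ × ℂ => Ap z.1 0 := by fun_prop
    have c6 : Continuous fun z : ℝ × ℂ => vv z.1 0 := by fun_prop
    have d1 := sr_cont c1 c3
    have d2 := sr_cont c2 c3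
    have d3 := sr_cont c5 c6
    have d4 := sr_cont c1 c4
    have e1 : Continuous fun z : ℝ × ℂ => (vp z.1 z.2 (vv z.1 z.2)) • ContinuousLinearMap.id ℂ G - (vp z.1 z.2).smulRight (vv z.1 z.2) :=
      ((c2.clm_apply c3).smul continuous_const).sub d2
    have e2 : Continuous fun z : ℝ × ℂ => (Ap z.1 z.2 (AA z.1 z.2)) • ContinuousLinearMap.id ℂ E - (Ap z.1 z.2).smulRight (AA z.1 z.2) :=
      ((c1.clm_apply c4).smul continuous_const).sub d4
    have e3 : ContinuousAt (fun z : ℝ × ℂ => (Zs + (z.1 : ℂ) • W) - t z.1 • (Ap z.1 0).smulRight (vv z.1 0)) (0, σ) := by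
      apply ContinuousAt.sub
      · fun_prop
      · exact ht.smul d3.continuousAt
    exact (ht.smul d1.continuousAt).add (hk.smul (e1.continuousAt.clm_comp (e3.clm_comp e2.continuousAt)))
  have hZsn : ‖Zs‖ < 1 := by
    have := block_norm A0 v0 hA hv 0 (by simp) (by simp) (1 / 2) (1 / 2) (by norm_num) (by norm_num) (by simp)
    rw [add_zero] at this
    rw [hZs]; linarith
  have htube : ∀ W, ∀ᶠ μ : ℝ in 𝓝 0, ∀ σ ∈ closedBall (0 : ℂ) 1, ‖Φ W μ σ‖ < 1 := by
    intro W
    apply (isCompact_closedBall (0 : ℂ) 1).eventually_forall_of_forall_eventually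
    intro σ _
    have := (hΦc W σ).norm
    refine this.eventually_lt_const ?_
    simpa [hΦ0] using hZsn
  have htubev : ∀ᶠ μ : ℝ in 𝓝 0, ∀ σ ∈ closedBall (0 : ℂ) 1, vv μ σ ≠ 0 := by
    apply (isCompact_closedBall (0 : ℂ) 1).eventually_forall_of_forall_eventually
    intro σ _
    have c3 : Continuous fun z : ℝ × ℂ => vv z.1 z.2 := by fun_prop
    apply c3.continuousAt.eventually_ne
    simp only [vv]; intro h; simp at h; simp [h] at hv
  have htubeA : ∀ᶠ μ : ℝ in 𝓝 0, ∀ σ ∈ closedBall (0 : ℂ) 1, AA μ σ ≠ 0 := by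
    apply (isCompact_closedBall (0 : ℂ) 1).eventually_forall_of_forall_eventually
    intro σ _
    have c3 : Continuous fun z : ℝ × ℂ => AA z.1 z.2 := by fun_prop
    apply c3.continuousAt.eventually_ne
    simp only [AA]; intro h; simp at h; simp [h] at hA
  have hmne : ∀ᶠ μ : ℝ in 𝓝 0, m μ ≠ 0 := by
    have : Continuous m := by fun_prop
    apply this.continuousAt.eventually_ne
    simp [hm0]
  filter_upwards [htube Y0, eventually_all.mpr fun i => htube (Y i), htubev, htubeA, hmne] with
    μ h0 hi hvne hAne hm
  -- value at `σ = 0`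
  have hval : ∀ W : E →L[ℂ] G, W A0 = b → (∀ x, inner ℂ v0 (W x) = inner ℂ v0 (Y0 x)) →
      Φ W μ 0 = Zs + (μ : ℂ) • W := by
    intro W hW1 hW2
    have x1 : inner ℂ v0 (vv μ 0) = m μ := by
      simp [vv, m, inner_add_right, inner_smul_right, hv, ← hτ1]
    have x2 : Ap μ 0 A0 = m μ := by
      simp [Ap, m, hA, hτ1']
    have tm : t μ * m μ = 1 / 2 := by
      simp only [t]; field_simp
    set X : E →L[ℂ] G := Zs + (μ : ℂ) • W - t μ • (Ap μ 0).smulRight (vv μ 0) with hX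
    have hXA : X A0 = 0 := by
      have : X A0 = (1 / 2 : ℂ) • v0 + (μ : ℂ) • b - (t μ * m μ) • vv μ 0 := by
        simp [hX, hZs, hA, hW1, x2, smul_smul]
      rw [this, tm]
      simp only [vv, smul_add, smul_smul]
      module
    have hvX : ∀ x, inner ℂ v0 (X x) = 0 := by
      intro x
      have : inner ℂ v0 (X x) = 1 / 2 * inner ℂ A0 x + μ * inner ℂ γ x - (t μ * m μ) * Ap μ 0 x := by
        simp [hX, hZs, inner_add_right, inner_sub_right, inner_smul_right, hv, hW2, hγx, x1]
        ring
      rw [this, tm]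
      simp [Ap]
      ring
    have e : Φ W μ 0 = t μ • (Ap μ 0).smulRight (vv μ 0) + X := by
      have a1 : AA μ 0 = A0 := by simp [AA]
      have a2 : vp μ 0 = innerSL ℂ v0 := by ext; simp [vp]
      ext x
      simp only [Φ, polFam, a1, a2, ← hX]
      simp only [_root_.add_apply, _root_.smul_apply, _root_.sub_apply,
        ContinuousLinearMap.comp_apply, ContinuousLinearMap.smulRight_apply, innerSL_apply_apply,
        ContinuousLinearMap.id_apply, x1, x2, map_sub, map_smul, hXA, hvX, inner_sub_right,
        inner_smul_right, smul_zero, sub_zero, mul_zero, zero_smul, smul_smul]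
      congr 1
      rw [inv_mul_cancel₀ (mul_ne_zero hm hm), one_smul]
    rw [e, hX]; abel
  have hdiff : ∀ W, Differentiable ℂ (Φ W μ) := by
    intro W
    have c1 : Differentiable ℂ (Ap μ) := by fun_prop
    have c2 : Differentiable ℂ (vp μ) := by fun_prop
    have c3 : Differentiable ℂ (vv μ) := by fun_prop
    have c4 : Differentiable ℂ (AA μ) := by fun_prop
    have e1 : Differentiable ℂ fun z : ℂ => (vp μ z (vv μ z)) • ContinuousLinearMap.id ℂ G - (vp μ z).smulRight (vv μ z) :=
      ((c2.clm_apply c3).smul_const _).sub (sr_diff c2 c3)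
    have e2 : Differentiable ℂ fun z : ℂ => (Ap μ z (AA μ z)) • ContinuousLinearMap.id ℂ E - (Ap μ z).smulRight (AA μ z) :=
      ((c1.clm_apply c4).smul_const _).sub (sr_diff c1 c4)
    have e3 := e1.clm_comp ((differentiable_const (𝕜 := ℂ) (E := ℂ)
      (Zs + (μ : ℂ) • W - t μ • (Ap μ 0).smulRight (vv μ 0))).clm_comp e2)
    exact ((sr_diff c1 c3).const_smul (t μ)).add (e3.const_smul (m μ * m μ)⁻¹)
  have hmain := ident_line (g := fun σ => mnr f l (Φ Y0 μ σ) (fun i => Φ (Y i) μ σ)) ?_ ?_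
  · rw [hval Y0 rfl (fun _ => rfl)] at hmain
    simpa only [fun i => hval (Y i) (hYA i) (hvY i)] using hmain
  · apply mnr_diff f hf l (Φ Y0 μ) (fun i => Φ (Y i) μ)
    · exact (hdiff _).differentiableOn
    · intro i; exact (hdiff _).differentiableOn
    · intro σ hσ; simpa using h0 σ (ball_subset_closedBall hσ)
    · intro i σ hσ; simpa using hi i σ (ball_subset_closedBall hσ)
  · intro σ hσ hre
    have hσ' := ball_subset_closedBall hσ
    have hconj : (starRingEnd ℂ) σ = 1 - σ := by
      apply Complex.ext
      · simp [hre]; norm_num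
      · simp
    have conj2 : (starRingEnd ℂ) (2 : ℂ) = 2 := Complex.conj_ofNat 2
    have hApe : Ap μ σ = innerSL ℂ (AA μ σ) := by
      ext x
      simp [Ap, AA, inner_add_left, inner_smul_left, hconj, conj2]
    have hvpe : vp μ σ = innerSL ℂ (vv μ σ) := by
      ext x
      simp [vp, vv, inner_add_left, inner_smul_left, hconj, conj2]
    have hspec := special_gen f hf hfm hfp l (AA μ σ) (vv μ σ) (hAne σ hσ') (hvne σ hσ') (t μ)
      (Φ Y0 μ σ - (t μ) • (innerSL ℂ (AA μ σ)).smulRight (vv μ σ))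
      (fun i => Φ (Y i) μ σ - (t μ) • (innerSL ℂ (AA μ σ)).smulRight (vv μ σ)) ?_ ?_ ?_ ?_ ?_ ?_
    · simpa using hspec
    · rw [← hApe]; exact polFam_A _ _ _ _ _ _ _ _ _
    · intro x; rw [← hApe, ← innerSL_apply_apply (𝕜 := ℂ), ← hvpe]; exact polFam_v _ _ _ _ _ _ _ _ _ _
    · intro i; rw [← hApe]; exact polFam_A _ _ _ _ _ _ _ _ _
    · intro i x; rw [← hApe, ← innerSL_apply_apply (𝕜 := ℂ), ← hvpe]; exact polFam_v _ _ _ _ _ _ _ _ _ _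
    · simpa using h0 σ hσ'
    · intro i; simpa using hi i σ hσ'

theorem minor_vanish (f : (E →L[ℂ] G) → (EuclideanSpace ℂ (Fin n) →L[ℂ] G'))
    (hf : DifferentiableOn ℂ f (ball 0 1)) (hfm : MapsTo f (ball 0 1) (ball 0 1))
    (hfp : ∀ r < 1, IsCompact (ball 0 1 ∩ f ⁻¹' (closedBall 0 r)))
    (l : Fin n → G' →L[ℂ] ℂ) (A : E) (v : G) (hA : A ≠ 0) (hv : v ≠ 0)
    (Z0 : E →L[ℂ] G) (Z : Fin n → E →L[ℂ] G) (hZ0 : ‖Z0‖ < 1) (hZ : ∀ i, ‖Z i‖ < 1)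
    (hZA : ∀ i, Z i A = Z0 A)
    (hvZ : ∀ i x, inner ℂ v (Z i x) = inner ℂ v (Z0 x)) : mnr f l Z0 Z = 0 := by
  set A1 : E := ((‖A‖ : ℝ) : ℂ)⁻¹ • A with hA1
  set v1 : G := ((‖v‖ : ℝ) : ℂ)⁻¹ • v with hv1
  have nA : ‖A1‖ = 1 := by simp [hA1, norm_smul, hA]
  have nv : ‖v1‖ = 1 := by simp [hv1, norm_smul, hv]
  set Zs : E →L[ℂ] G := (1 / 2 : ℂ) • (innerSL ℂ A1).smulRight v1 with hZs
  have hZsn : ‖Zs‖ < 1 := by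
    have := block_norm A1 v1 nA nv 0 (by simp) (by simp) (1 / 2) (1 / 2) (by norm_num) (by norm_num) (by simp)
    rw [add_zero] at this
    rw [hZs]; linarith
  have hnp := near_polar f hf hfm hfp l A1 v1 nA nv (Z0 - Zs) (fun i => Z i - Zs)
    (by intro i; simp [hA1, hZA]) (by intro i x; simp [hv1, inner_sub_right, inner_smul_left, hvZ])
  rw [← hZs] at hnp
  have c0 : ∀ W : E →L[ℂ] G, Continuous fun s : ℂ => Zs + s • (W - Zs) := by intro W; fun_prop
  let T : (E →L[ℂ] G) → Set ℂ := fun W => (fun s : ℂ => Zs + s • (W - Zs)) ⁻¹' ball 0 1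
  have hTo : ∀ W, IsOpen (T W) := fun W => isOpen_ball.preimage (c0 W)
  have hTc : ∀ W, Convex ℝ (T W) := by
    intro W x hx y hy a b ha hb hab
    have := convex_ball (0 : E →L[ℂ] G) 1 hx hy ha hb hab
    change Zs + (a • x + b • y) • (W - Zs) ∈ ball (0 : E →L[ℂ] G) 1
    convert this using 1
    have : Zs = (a + b) • Zs := by rw [hab, one_smul]
    nth_rewrite 1 [this]
    simp only [add_smul, smul_add, smul_assoc]
    abel
  have hT0 : ∀ W, (0 : ℂ) ∈ T W := fun W => by simpa [T] using hZsn
  have hT1 : ∀ W : E →L[ℂ] G, ‖W‖ < 1 → (1 : ℂ) ∈ T W := fun W h => by simpa [T] using h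
  have := ident_seg (g := fun s => mnr f l (Zs + s • (Z0 - Zs)) (fun i => Zs + s • (Z i - Zs)))
    (S := T Z0 ∩ ⋂ i, T (Z i)) ((hTo Z0).inter (isOpen_iInter_of_finite fun i => hTo _))
    ((hTc Z0).inter (convex_iInter fun i => hTc _)) ⟨hT0 _, mem_iInter.mpr fun i => hT0 _⟩
    ⟨hT1 _ hZ0, mem_iInter.mpr fun i => hT1 _ (hZ i)⟩ ?_ hnp
  · simpa using this
  · apply mnr_diff f hf l (fun s => Zs + s • (Z0 - Zs)) (fun i s => Zs + s • (Z i - Zs))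
    · fun_prop
    · intro i; fun_prop
    · intro s hs; exact hs.1
    · intro i s hs; exact mem_iInter.mp hs.2 i

/-- If all minors vanish then there is a common kernel vector. -/
theorem common_kernel (f : (E →L[ℂ] G) → (EuclideanSpace ℂ (Fin n) →L[ℂ] G'))
    (Z0 : E →L[ℂ] G) (T : Set (E →L[ℂ] G))
    (h : ∀ (l : Fin n → G' →L[ℂ] ℂ) (Z : Fin n → E →L[ℂ] G), (∀ i, Z i ∈ T) → mnr f l Z0 Z = 0) :
    ∃ C : EuclideanSpace ℂ (Fin n), C ≠ 0 ∧ ∀ Z ∈ T, f Z C = f Z0 C := by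
  let rw' : (G' →L[ℂ] ℂ) → (E →L[ℂ] G) → Fin n → ℂ := fun l Z k =>
    l ((f Z - f Z0) (EuclideanSpace.single k 1))
  let S : Set (Fin n → ℂ) := {r | ∃ l, ∃ Z ∈ T, r = rw' l Z}
  have hdep : Submodule.span ℂ S ≠ ⊤ := by
    intro htop
    obtain ⟨b, hbS, -, hb⟩ := Submodule.exists_fun_fin_finrank_span_eq ℂ S
    have hfr : Module.finrank ℂ (Submodule.span ℂ S) = n := by rw [htop]; simp
    let b' : Fin n → Fin n → ℂ := fun i => b (Fin.cast hfr.symm i)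
    have hb' : LinearIndependent ℂ b' := hb.comp _ (Fin.cast_injective _)
    have hbS' : ∀ i, b' i ∈ S := fun i => hbS _
    choose l Z hZ hr using hbS'
    have h0 := h l Z hZ
    have hu := (Matrix.linearIndependent_rows_iff_isUnit (A := Matrix.of b')).mp hb'
    rw [Matrix.isUnit_iff_isUnit_det] at hu
    apply hu.ne_zero
    rw [← h0]
    unfold mnr
    congr 1
    ext i k
    simp [hr, rw']
  obtain ⟨φ, hφ, hle⟩ := Submodule.exists_le_ker_of_lt_top _ (lt_top_iff_ne_top.mpr hdep)
  let C : EuclideanSpace ℂ (Fin n) := ∑ k, φ (Pi.single k 1) • EuclideanSpace.single k (1 : ℂ)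
  refine ⟨C, ?_, ?_⟩
  · intro hC
    apply hφ
    apply LinearMap.pi_ext'
    intro k
    ext
    have := congrArg (fun x : EuclideanSpace ℂ (Fin n) => x k) hC
    simpa [C, Finset.sum_apply, Pi.single_apply] using this
  · intro Z hZ
    rw [← sub_eq_zero]
    apply inner_self_eq_zero (𝕜 := ℂ).mp
    have h1 : rw' (innerSL ℂ (f Z C - f Z0 C)) Z ∈ LinearMap.ker φ :=
      hle (Submodule.subset_span ⟨_, Z, hZ, rfl⟩)
    rw [LinearMap.mem_ker] at h1
    rw [← h1]
    conv_rhs => rw [pi_eq_sum_univ' (rw' (innerSL ℂ (f Z C - f Z0 C)) Z)]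
    generalize hu : f Z C - f Z0 C = u
    have : u = (f Z - f Z0) C := by rw [← hu]; rfl
    nth_rewrite 2 [this]
    simp only [C, map_sum, map_smul, inner_sum, inner_smul_right, rw', innerSL_apply_apply, smul_eq_mul]
    apply Finset.sum_congr rfl
    intro k _
    rw [mul_comm]

theorem pathset_open {V : Type*} [NormedAddCommGroup V] [NormedSpace ℂ V] (a b : V) :
    IsOpen {s : ℂ | a + s • b ∈ ball (0 : V) 1} :=
  isOpen_ball.preimage (by fun_prop : Continuous fun s : ℂ => a + s • b)

theorem pathset_convex {V : Type*} [NormedAddCommGroup V] [NormedSpace ℂ V] (a b : V) :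
    Convex ℝ {s : ℂ | a + s • b ∈ ball (0 : V) 1} := by
  intro x hx y hy c d hc hd hcd
  have := convex_ball (0 : V) 1 hx hy hc hd hcd
  change a + (c • x + d • y) • b ∈ ball (0 : V) 1
  convert this using 1
  have : a = (c + d) • a := by rw [hcd, one_smul]
  nth_rewrite 1 [this]
  simp only [add_smul, smul_add, smul_assoc]
  abel

/-- The space of vectors on which `f` is constant in directions with range in `R`. -/
def Nsub (f : (E →L[ℂ] G) → (EuclideanSpace ℂ (Fin n) →L[ℂ] G')) (A : E) (Z : E →L[ℂ] G)
    (R : Submodule ℂ G) : Submodule ℂ (EuclideanSpace ℂ (Fin n)) where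
  carrier := {C | ∀ X : E →L[ℂ] G, X A = 0 → (∀ x, X x ∈ R) → ‖Z + X‖ < 1 → f (Z + X) C = f Z C}
  add_mem' := by
    intro a b ha hb X h1 h2 h3
    rw [map_add, map_add, ha X h1 h2 h3, hb X h1 h2 h3]
  zero_mem' := by intro X _ _ _; simp
  smul_mem' := by
    intro c a ha X h1 h2 h3
    rw [map_smul, map_smul, ha X h1 h2 h3]

theorem mem_Nsub {f : (E →L[ℂ] G) → (EuclideanSpace ℂ (Fin n) →L[ℂ] G')} {A : E} {Z : E →L[ℂ] G}
    {R : Submodule ℂ G} {C : EuclideanSpace ℂ (Fin n)} : C ∈ Nsub f A Z R ↔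
    ∀ X : E →L[ℂ] G, X A = 0 → (∀ x, X x ∈ R) → ‖Z + X‖ < 1 → f (Z + X) C = f Z C := Iff.rfl

theorem Nsub_anti (f : (E →L[ℂ] G) → (EuclideanSpace ℂ (Fin n) →L[ℂ] G')) (A : E) (Z : E →L[ℂ] G)
    {R R' : Submodule ℂ G} (h : R ≤ R') : Nsub f A Z R' ≤ Nsub f A Z R := by
  intro C hC X h1 h2 h3
  exact hC X h1 (fun x => h (h2 x)) h3

theorem Nsub_semi (f : (E →L[ℂ] G) → (EuclideanSpace ℂ (Fin n) →L[ℂ] G'))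
    (hf : DifferentiableOn ℂ f (ball 0 1)) (A : E) (Z1 : E →L[ℂ] G) (hZ1 : ‖Z1‖ < 1)
    (R : Submodule ℂ G) :
    ∀ᶠ Z in 𝓝 Z1, Module.finrank ℂ (Nsub f A Z R) ≤ Module.finrank ℂ (Nsub f A Z1 R) := by
  set M := (Nsub f A Z1 R)ᗮ with hM
  have hcont : ∀ W : E →L[ℂ] G, ‖W‖ < 1 → ContinuousAt f W := fun W hW =>
    (hf.differentiableAt (isOpen_ball.mem_nhds (by simpa using hW))).continuousAt
  have hK : IsCompact (sphere (0 : EuclideanSpace ℂ (Fin n)) 1 ∩ (M : Set _)) :=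
    (isCompact_sphere _ _).inter_right M.closed_of_finiteDimensional
  have key : ∀ᶠ Z in 𝓝 Z1, ∀ C ∈ sphere (0 : EuclideanSpace ℂ (Fin n)) 1 ∩ (M : Set _),
      C ∉ Nsub f A Z R := by
    apply hK.eventually_forall_of_forall_eventually
    rintro C ⟨hC1, hCM⟩
    have hCN : C ∉ Nsub f A Z1 R := by
      intro hCN
      have : C = 0 := by
        have := Submodule.inner_right_of_mem_orthogonal hCN hCM
        exact inner_self_eq_zero.mp this
      simp [this] at hC1
    rw [mem_Nsub] at hCN
    push Not at hCN
    obtain ⟨X, hXA, hXR, hXn, hXne⟩ := hCN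
    have c1 : ContinuousAt (fun z : (E →L[ℂ] G) × EuclideanSpace ℂ (Fin n) => f (z.1 + X) z.2) (Z1, C) := by
      have : ContinuousAt (fun z : (E →L[ℂ] G) × EuclideanSpace ℂ (Fin n) => f (z.1 + X)) (Z1, C) :=
        ContinuousAt.comp (g := f) (f := fun z : (E →L[ℂ] G) × EuclideanSpace ℂ (Fin n) => z.1 + X)
          (hcont _ hXn) (by fun_prop)
      exact this.clm_apply continuousAt_snd
    have c2 : ContinuousAt (fun z : (E →L[ℂ] G) × EuclideanSpace ℂ (Fin n) => f z.1 z.2) (Z1, C) := by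
      have : ContinuousAt (fun z : (E →L[ℂ] G) × EuclideanSpace ℂ (Fin n) => f z.1) (Z1, C) :=
        ContinuousAt.comp (g := f) (f := fun z : (E →L[ℂ] G) × EuclideanSpace ℂ (Fin n) => z.1)
          (hcont _ hZ1) (by fun_prop)
      exact this.clm_apply continuousAt_snd
    have c3 : ContinuousAt (fun z : (E →L[ℂ] G) × EuclideanSpace ℂ (Fin n) => ‖z.1 + X‖) (Z1, C) := by
      fun_prop
    have e1 := (c1.sub c2).eventually_ne (y := 0) (by simpa [sub_eq_zero] using hXne)
    have e2 := c3.eventually_lt_const (u := 1) hXn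
    filter_upwards [e1, e2] with z h1 h2 h3
    apply h1
    change f (z.1 + X) z.2 - f z.1 z.2 = 0
    rw [h3 X hXA hXR h2, sub_self]
  filter_upwards [key] with Z hZ
  have hdisj : Nsub f A Z R ⊓ M = ⊥ := by
    rw [Submodule.eq_bot_iff]
    rintro C ⟨h1, h2⟩
    by_contra hC
    refine hZ (((‖C‖ : ℝ) : ℂ)⁻¹ • C) ⟨?_, M.smul_mem _ h2⟩ (Submodule.smul_mem _ _ h1)
    simp [norm_smul, hC]
  have h1 := Submodule.finrank_sup_add_finrank_inf_eq (Nsub f A Z R) M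
  rw [hdisj, finrank_bot, add_zero] at h1
  have h2 := Submodule.finrank_add_finrank_orthogonal (Nsub f A Z1 R)
  rw [← hM] at h2
  have h3 := Submodule.finrank_le (Nsub f A Z R ⊔ M)
  omega

theorem core_constant (f : (E →L[ℂ] G) → (EuclideanSpace ℂ (Fin n) →L[ℂ] G'))
    (hf : DifferentiableOn ℂ f (ball 0 1)) (A : E)
    (hnp : n < Module.finrank ℂ G)
    (H : ∀ Z : E →L[ℂ] G, ‖Z‖ < 1 → ∀ R : Submodule ℂ G, R ≠ ⊤ → Nsub f A Z R ≠ ⊥)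
    (Z0 : E →L[ℂ] G) (hZ0 : ‖Z0‖ < 1) :
    ∃ C : EuclideanSpace ℂ (Fin n), C ≠ 0 ∧ ∀ Z : E →L[ℂ] G, ‖Z‖ < 1 → Z A = Z0 A → f Z C = f Z0 C := by
  let P : ℕ → Prop := fun k => ∃ Z1 : E →L[ℂ] G, ‖Z1‖ < 1 ∧ Z1 A = Z0 A ∧ ∃ R : Submodule ℂ G,
    Module.finrank ℂ R ≤ k ∧ Module.finrank ℂ (Nsub f A Z1 R) + k ≤ n
  have hP0 : P 0 := by
    refine ⟨Z0, hZ0, rfl, ⊥, by simp, ?_⟩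
    have := Submodule.finrank_le (Nsub f A Z0 ⊥)
    simpa using this
  have hPn : ¬ P n := by
    rintro ⟨Z1, h1, -, R, h2, h3⟩
    apply H Z1 h1 R
    · rintro rfl
      rw [finrank_top] at h2
      omega
    · rw [← Submodule.finrank_eq_zero (R := ℂ)]
      omega
  obtain ⟨k, hkn, hk, hk1⟩ : ∃ k < n, P k ∧ ¬ P (k + 1) := by
    by_contra hcon
    push Not at hcon
    apply hPn
    have : ∀ k, k ≤ n → P k := by
      intro k
      induction k with
      | zero => exact fun _ => hP0
      | succ k ih => exact fun h => hcon k (by omega) (ih (by omega))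
    exact this n le_rfl
  obtain ⟨Z1, hZ1, hZ1A, R, hR, hN⟩ := hk
  have hbig : ∀ Z : E →L[ℂ] G, ‖Z‖ < 1 → Z A = Z0 A → ∀ R' : Submodule ℂ G,
      Module.finrank ℂ R' ≤ k + 1 → n < Module.finrank ℂ (Nsub f A Z R') + (k + 1) := by
    intro Z h1 h2 R' h3
    by_contra h4
    exact hk1 ⟨Z, h1, h2, R', h3, by omega⟩
  have hev : ∀ᶠ Z in 𝓝 Z1, ‖Z‖ < 1 ∧
      Module.finrank ℂ (Nsub f A Z R) ≤ Module.finrank ℂ (Nsub f A Z1 R) :=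
    (continuousAt_id.norm.eventually_lt_const hZ1).and (Nsub_semi f hf A Z1 hZ1 R)
  obtain ⟨ε, hε, hεb⟩ := Metric.eventually_nhds_iff.mp hev
  -- one step
  have step : ∀ Z : E →L[ℂ] G, dist Z Z1 < ε → Z A = Z0 A → ∀ C ∈ Nsub f A Z R,
      ∀ (y : E →L[ℂ] ℂ) (r : G), y A = 0 → dist (Z + y.smulRight r) Z1 < ε →
      f (Z + y.smulRight r) C = f Z C ∧ C ∈ Nsub f A (Z + y.smulRight r) R := by
    intro Z hZ hZA C hC y r hy hd
    obtain ⟨hZ1', hZf⟩ := hεb hZ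
    obtain ⟨hZ2', -⟩ := hεb hd
    have hRr : Module.finrank ℂ (R ⊔ Submodule.span ℂ {r} : Submodule ℂ G) ≤ k + 1 := by
      have a := Submodule.finrank_add_le_finrank_add_finrank R (Submodule.span ℂ {r})
      have b : Module.finrank ℂ (Submodule.span ℂ {r}) ≤ 1 := by
        simpa using finrank_span_le_card (R := ℂ) ({r} : Set G)
      omega
    have heq : Nsub f A Z (R ⊔ Submodule.span ℂ {r}) = Nsub f A Z R := by
      apply Submodule.eq_of_le_of_finrank_le (Nsub_anti f A Z le_sup_left)
      have := hbig Z hZ1' hZA _ hRr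
      omega
    rw [← heq] at hC
    have hmem : ∀ x, y.smulRight r x ∈ R ⊔ Submodule.span ℂ {r} := fun x =>
      Submodule.mem_sup_right (Submodule.smul_mem _ _ (Submodule.mem_span_singleton_self r))
    have h1 := hC (y.smulRight r) (by simp [hy]) hmem hZ2'
    refine ⟨h1, ?_⟩
    intro X hXA hXR hXn
    rw [h1, add_assoc]
    apply hC
    · simp [hy, hXA]
    · intro x
      exact Submodule.add_mem _ (hmem x) (Submodule.mem_sup_left (hXR x))
    · rwa [← add_assoc]
  set p := Module.finrank ℂ G with hp
  let e := stdOrthonormalBasis ℂ G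
  have local1 : ∀ Z : E →L[ℂ] G, Z A = Z0 A → p * ‖Z - Z1‖ < ε → ∀ C ∈ Nsub f A Z1 R,
      f Z C = f Z1 C := by
    intro Z hZA hZd C hC
    let X : Finset (Fin p) → E →L[ℂ] G := fun s =>
      ∑ i ∈ s, ((innerSL ℂ (e i)) ∘L (Z - Z1)).smulRight (e i)
    have hXd : ∀ s, dist (Z1 + X s) Z1 < ε := by
      intro s
      rw [dist_eq_norm, add_sub_cancel_left]
      refine lt_of_le_of_lt ?_ hZd
      refine (norm_sum_le _ _).trans ?_
      have : ∀ i ∈ s, ‖((innerSL ℂ (e i)) ∘L (Z - Z1)).smulRight (e i)‖ ≤ ‖Z - Z1‖ := by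
        intro i _
        rw [ContinuousLinearMap.norm_smulRight_apply, e.orthonormal.1 i, mul_one]
        refine (ContinuousLinearMap.opNorm_comp_le _ _).trans ?_
        rw [innerSL_apply_norm, e.orthonormal.1 i, one_mul]
      refine (Finset.sum_le_sum this).trans ?_
      rw [Finset.sum_const, nsmul_eq_mul]
      gcongr
      simpa using Finset.card_le_univ s
    have hXA : ∀ s, (Z1 + X s) A = Z0 A := by
      intro s
      simp [X, hZA, hZ1A]
    have hind : ∀ s, f (Z1 + X s) C = f Z1 C ∧ C ∈ Nsub f A (Z1 + X s) R := by
      intro s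
      induction s using Finset.induction_on with
      | empty => simpa [X] using hC
      | insert i s his ih =>
        have hXi : Z1 + X (insert i s) =
            (Z1 + X s) + ((innerSL ℂ (e i)) ∘L (Z - Z1)).smulRight (e i) := by
          simp only [X, Finset.sum_insert his]; abel
        have := step (Z1 + X s) (hXd s) (hXA s) C ih.2 ((innerSL ℂ (e i)) ∘L (Z - Z1)) (e i)
          (by simp [hZA, hZ1A]) (by rw [← hXi]; exact hXd _)
        rw [hXi]
        exact ⟨this.1.trans ih.1, this.2⟩
    have hfull : Z1 + X Finset.univ = Z := by
      ext x
      have := e.sum_repr' (Z x - Z1 x)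
      have h2 : X Finset.univ x = Z x - Z1 x := by
        rw [← this]
        simp [X, inner_sub_right]
        rfl
      rw [_root_.add_apply, h2]; abel
    have := (hind Finset.univ).1
    rwa [hfull] at this
  have glob : ∀ Z : E →L[ℂ] G, ‖Z‖ < 1 → Z A = Z0 A → ∀ C ∈ Nsub f A Z1 R, f Z C = f Z1 C := by
    intro Z hZ hZA C hC
    rw [← sub_eq_zero]
    apply inner_self_eq_zero (𝕜 := ℂ).mp
    generalize hu : f Z C - f Z1 C = u
    have := ident_seg (g := fun s => inner ℂ u (f (Z1 + s • (Z - Z1)) C - f Z1 C))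
      (pathset_open Z1 (Z - Z1)) (pathset_convex Z1 (Z - Z1)) (by simpa using hZ1)
      (by simpa using hZ) ?_ ?_
    · simpa [hu] using this
    · have h1 : DifferentiableOn ℂ (fun s : ℂ => f (Z1 + s • (Z - Z1)))
          {s : ℂ | Z1 + s • (Z - Z1) ∈ ball (0 : E →L[ℂ] G) 1} :=
        hf.comp (by fun_prop) (fun s hs => hs)
      have h2 := h1.clm_apply (differentiableOn_const C)
      exact (innerSL ℂ u).differentiable.comp_differentiableOn (h2.sub_const (f Z1 C))
    · have hc : ContinuousAt (fun μ : ℝ => p * ‖(Z1 + (μ : ℂ) • (Z - Z1)) - Z1‖) 0 := by fun_prop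
      filter_upwards [hc.eventually_lt_const (u := ε) (by simpa using hε)] with μ hμ
      rw [local1 _ (by simp [hZA, hZ1A]) hμ C hC, sub_self, inner_zero_right]
  have hne : Nsub f A Z1 R ≠ ⊥ := by
    intro hbot
    have := hbig Z1 hZ1 hZ1A R (by omega)
    rw [hbot, finrank_bot] at this
    omega
  obtain ⟨C, hC, hC0⟩ := Submodule.exists_mem_ne_zero_of_ne_bot hne
  exact ⟨C, hC0, fun Z hZ hZA => (glob Z hZ hZA C hC).trans (glob Z0 hZ0 rfl C hC).symm⟩

theorem core (f : (E →L[ℂ] G) → (EuclideanSpace ℂ (Fin n) →L[ℂ] G'))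
    (hf : DifferentiableOn ℂ f (ball 0 1)) (hfm : MapsTo f (ball 0 1) (ball 0 1))
    (hfp : ∀ r < 1, IsCompact (ball 0 1 ∩ f ⁻¹' (closedBall 0 r)))
    (hnp : n < Module.finrank ℂ G) (A : E) (hA : A ≠ 0)
    (Z0 : E →L[ℂ] G) (hZ0 : ‖Z0‖ < 1) :
    ∃ C : EuclideanSpace ℂ (Fin n), C ≠ 0 ∧ ∀ Z : E →L[ℂ] G, ‖Z‖ < 1 → Z A = Z0 A → f Z C = f Z0 C := by
  apply core_constant f hf A hnp _ Z0 hZ0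
  intro Z1 hZ1 R hR
  obtain ⟨v, hvR, hv⟩ := Submodule.exists_mem_ne_zero_of_ne_bot
    (mt (Submodule.orthogonal_eq_bot_iff (K := R)).mp hR)
  obtain ⟨C, hC, hCT⟩ := common_kernel f Z1
    {Z | ‖Z‖ < 1 ∧ Z A = Z1 A ∧ ∀ x, inner ℂ v (Z x) = inner ℂ v (Z1 x)}
    (fun l Z h => minor_vanish f hf hfm hfp l A v hA hv Z1 Z hZ1 (fun i => (h i).1)
      (fun i => (h i).2.1) (fun i => (h i).2.2))
  intro hbot
  apply hC
  rw [← Submodule.mem_bot ℂ, ← hbot]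
  intro X hXA hXR hXn
  apply hCT
  refine ⟨hXn, by simp [hXA], fun x => ?_⟩
  rw [_root_.add_apply, inner_add_right, Submodule.inner_left_of_mem_orthogonal (hXR x) hvR, add_zero]

/-- Matrices as continuous linear maps between Euclidean spaces. -/
noncomputable def M2L (m n : ℕ) : Matrix (Fin m) (Fin n) ℂ ≃L[ℂ]
    (EuclideanSpace ℂ (Fin n) →L[ℂ] EuclideanSpace ℂ (Fin m)) :=
  (Matrix.toEuclideanLin ≪≫ₗ LinearMap.toContinuousLinearMap).toContinuousLinearEquiv

theorem M2L_apply {m n : ℕ} (Z : Matrix (Fin m) (Fin n) ℂ) (x : EuclideanSpace ℂ (Fin n)) :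
    M2L m n Z x = WithLp.toLp 2 (Z *ᵥ x.ofLp) := rfl

theorem norm_sq_toLp {n : ℕ} (x : Fin n → ℂ) :
    ‖(WithLp.toLp 2 x : EuclideanSpace ℂ (Fin n))‖ ^ 2 = ∑ i, ‖x i‖ ^ 2 := by
  rw [EuclideanSpace.norm_sq_eq]

theorem star_dot_self {n : ℕ} (x : Fin n → ℂ) : star x ⬝ᵥ x = ((∑ i, ‖x i‖ ^ 2 : ℝ) : ℂ) := by
  simp only [dotProduct, Pi.star_apply, RCLike.star_def, Complex.conj_mul']
  push_cast
  rfl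

theorem form_eq {m n : ℕ} (Z : Matrix (Fin m) (Fin n) ℂ) (x : Fin n → ℂ) :
    star x ⬝ᵥ ((1 - Zᴴ * Z) *ᵥ x) = ((∑ i, ‖x i‖ ^ 2 - ∑ i, ‖(Z *ᵥ x) i‖ ^ 2 : ℝ) : ℂ) := by
  rw [Complex.ofReal_sub, ← star_dot_self, ← star_dot_self, Matrix.sub_mulVec, dotProduct_sub,
    Matrix.one_mulVec, ← Matrix.mulVec_mulVec, Matrix.star_mulVec, Matrix.dotProduct_mulVec]

theorem typeI_pointwise {m n : ℕ} (Z : Matrix (Fin m) (Fin n) ℂ) : Z ∈ typeIDomain m n ↔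
    ∀ x : Fin n → ℂ, x ≠ 0 → ∑ i, ‖(Z *ᵥ x) i‖ ^ 2 < ∑ i, ‖x i‖ ^ 2 := by
  constructor
  · intro h x hx
    have := Matrix.PosDef.dotProduct_mulVec_pos h hx
    rw [form_eq, Complex.zero_lt_real] at this
    linarith
  · intro h
    apply Matrix.PosDef.of_dotProduct_mulVec_pos
    · exact Matrix.isHermitian_one.sub (Matrix.isHermitian_conjTranspose_mul_self Z)
    · intro x hx
      rw [form_eq, Complex.zero_lt_real]
      linarith [h x hx]

theorem typeI_iff {m n : ℕ} (Z : Matrix (Fin m) (Fin n) ℂ) : Z ∈ typeIDomain m n ↔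
    ‖M2L m n Z‖ < 1 := by
  rw [typeI_pointwise]
  constructor
  · intro h
    by_contra hcon
    push Not at hcon
    set H := M2L m n Z with hH
    have hpos : 0 < ‖H‖ := by linarith
    obtain ⟨C, hC, hHC⟩ := norm_attained (((‖H‖ : ℝ) : ℂ)⁻¹ • H) (by
      rw [norm_smul, norm_inv, Complex.norm_real, norm_norm, inv_mul_cancel₀ hpos.ne'])
    have hC0 : C.ofLp ≠ 0 := by
      intro h0
      have : C = 0 := by ext i; exact congrFun h0 i
      simp [this] at hC
    have h1 := h C.ofLp hC0
    rw [← norm_sq_toLp, ← norm_sq_toLp] at h1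
    change ‖H C‖ ^ 2 < ‖C‖ ^ 2 at h1
    rw [_root_.smul_apply, norm_smul, norm_inv, Complex.norm_real, norm_norm] at hHC
    have h2 : ‖H C‖ = ‖H‖ := by field_simp at hHC; exact hHC
    rw [h2, hC] at h1
    nlinarith
  · intro h x hx
    rw [← norm_sq_toLp, ← norm_sq_toLp]
    have h1 := (M2L m n Z).le_opNorm (WithLp.toLp 2 x)
    have h2 : 0 < ‖(WithLp.toLp 2 x : EuclideanSpace ℂ (Fin n))‖ := by
      rw [norm_pos_iff]
      intro h0
      apply hx
      simpa using congrArg WithLp.ofLp h0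
    have h3 : ‖M2L m n Z (WithLp.toLp 2 x)‖ < ‖(WithLp.toLp 2 x : EuclideanSpace ℂ (Fin n))‖ := by
      nlinarith
    change ‖M2L m n Z (WithLp.toLp 2 x)‖ ^ 2 < _
    gcongr

theorem typeI_transpose {m n : ℕ} {Z : Matrix (Fin m) (Fin n) ℂ} (hZ : Z ∈ typeIDomain m n) :
    Zᵀ ∈ typeIDomain n m := by
  have h1 : M2L n m Zᴴ = ContinuousLinearMap.adjoint (M2L m n Z) := by
    have := Matrix.toEuclideanLin_conjTranspose_eq_adjoint Z
    rw [ContinuousLinearMap.eq_adjoint_iff]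
    intro x y
    have h2 := LinearMap.adjoint_inner_left (Matrix.toEuclideanLin Z) y x
    rw [← this] at h2
    exact h2
  have h2 : Zᴴ ∈ typeIDomain n m := by
    rw [typeI_iff, h1, LinearIsometryEquiv.norm_map, ← typeI_iff]
    exact hZ
  rw [typeI_pointwise] at h2 ⊢
  intro x hx
  have h3 := h2 (star x) (by simpa using hx)
  have h4 : Zᴴ *ᵥ star x = star (Zᵀ *ᵥ x) := by
    rw [Matrix.star_mulVec, ← Matrix.mulVec_transpose]
    congr 1
  rw [h4] at h3
  simpa using h3

theorem typeI_eq {m n : ℕ} : typeIDomain m n = M2L m n ⁻¹' ball 0 1 := by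
  ext Z
  rw [typeI_iff]
  simp

theorem typeI_open {m n : ℕ} : IsOpen (typeIDomain m n) := by
  rw [typeI_eq]
  exact isOpen_ball.preimage (M2L m n).continuous

theorem core_mat {p q p' q' : ℕ} (hq'p : q' < p)
    (f : Matrix (Fin p) (Fin q) ℂ → Matrix (Fin p') (Fin q') ℂ)
    (hf : DifferentiableOn ℂ f (typeIDomain p q))
    (hfp : ProperOn f (typeIDomain p q) (typeIDomain p' q'))
    (A : Fin q → ℂ) (hA : A ≠ 0) (Z0 : Matrix (Fin p) (Fin q) ℂ) (hZ0 : Z0 ∈ typeIDomain p q) :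
    ∃ C : Fin q' → ℂ, C ≠ 0 ∧ ∀ Z ∈ typeIDomain p q, Z *ᵥ A = Z0 *ᵥ A → f Z *ᵥ C = f Z0 *ᵥ C := by
  let F : (EuclideanSpace ℂ (Fin q) →L[ℂ] EuclideanSpace ℂ (Fin p)) →
      (EuclideanSpace ℂ (Fin q') →L[ℂ] EuclideanSpace ℂ (Fin p')) :=
    fun T => M2L p' q' (f ((M2L p q).symm T))
  have hms : MapsTo (M2L p q).symm (ball 0 1) (typeIDomain p q) := by
    intro T hT
    rw [typeI_iff]
    simpa using hT
  have hF : DifferentiableOn ℂ F (ball 0 1) :=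
    (M2L p' q').differentiable.comp_differentiableOn
      (hf.comp (M2L p q).symm.differentiable.differentiableOn hms)
  have hFm : MapsTo F (ball 0 1) (ball 0 1) := by
    intro T hT
    have := hfp.1 (hms hT)
    rw [typeI_eq] at this
    exact this
  have hFp : ∀ r < 1, IsCompact (ball 0 1 ∩ F ⁻¹' (closedBall 0 r)) := by
    intro r hr
    have hK : IsCompact ((M2L p' q').symm '' closedBall 0 r) :=
      (isCompact_closedBall _ _).image (M2L p' q').symm.continuous
    have hKs : (M2L p' q').symm '' closedBall 0 r ⊆ typeIDomain p' q' := by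
      rintro _ ⟨T, hT, rfl⟩
      rw [typeI_iff]
      simp only [ContinuousLinearEquiv.apply_symm_apply]
      have : ‖T‖ ≤ r := by simpa using hT
      linarith
    have h1 := (hfp.2 _ hKs hK).image (M2L p q).continuous
    convert h1 using 1
    ext T
    constructor
    · rintro ⟨h2, h3⟩
      exact ⟨(M2L p q).symm T, ⟨hms h2, F T, h3, by simp [F]⟩, by simp⟩
    · rintro ⟨Z, ⟨h2, S, h3, h4⟩, rfl⟩
      rw [typeI_eq] at h2
      refine ⟨h2, ?_⟩
      simp only [mem_preimage, F, ContinuousLinearEquiv.symm_apply_apply, ← h4,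
        ContinuousLinearEquiv.apply_symm_apply]
      exact h3
  obtain ⟨C, hC, hCZ⟩ := core F hF hFm hFp (by simpa using hq'p) (WithLp.toLp 2 A)
    (by intro h0; apply hA; simpa using congrArg WithLp.ofLp h0) (M2L p q Z0) ((typeI_iff Z0).mp hZ0)
  refine ⟨C.ofLp, ?_, ?_⟩
  · intro h0; apply hC; ext i; exact congrFun h0 i
  · intro Z hZ hZA
    have := hCZ (M2L p q Z) ((typeI_iff Z).mp hZ) (by rw [M2L_apply, M2L_apply, hZA])
    simp only [F, ContinuousLinearEquiv.symm_apply_apply, M2L_apply] at this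
    exact congrArg WithLp.ofLp this

theorem cone_ne {q p : ℕ} {x : (Fin q → ℂ) × (Fin p → ℂ)} (hx : x ∈ genBallCone q p) : x.1 ≠ 0 := by
  intro h
  have h1 : ∑ j, ‖x.2 j‖ ^ 2 < ∑ i, ‖x.1 i‖ ^ 2 := hx
  rw [h] at h1
  simp at h1
  have : 0 ≤ ∑ j, ‖x.2 j‖ ^ 2 := by positivity
  linarith

theorem fiber_nonempty {q p : ℕ} {x : (Fin q → ℂ) × (Fin p → ℂ)} (hx : x ∈ genBallCone q p) :
    ∃ Z ∈ typeIDomain p q, Z *ᵥ x.1 = x.2 := by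
  set a : EuclideanSpace ℂ (Fin q) := WithLp.toLp 2 x.1 with ha
  set b : EuclideanSpace ℂ (Fin p) := WithLp.toLp 2 x.2 with hb
  have ha0 : a ≠ 0 := by
    intro h0; apply cone_ne hx; exact congrArg WithLp.ofLp h0
  have hpos : 0 < ‖a‖ := norm_pos_iff.mpr ha0
  have hlt : ‖b‖ < ‖a‖ := by
    have h1 : ∑ j, ‖x.2 j‖ ^ 2 < ∑ i, ‖x.1 i‖ ^ 2 := hx
    rw [← norm_sq_toLp, ← norm_sq_toLp] at h1
    exact lt_of_pow_lt_pow_left₀ 2 (norm_nonneg _) h1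
  let T : EuclideanSpace ℂ (Fin q) →L[ℂ] EuclideanSpace ℂ (Fin p) :=
    (((‖a‖ : ℝ) : ℂ) ^ 2)⁻¹ • (innerSL ℂ a).smulRight b
  have hc : ((‖a‖ : ℝ) : ℂ) ≠ 0 := by exact_mod_cast hpos.ne'
  refine ⟨(M2L p q).symm T, ?_, ?_⟩
  · rw [typeI_iff, ContinuousLinearEquiv.apply_symm_apply, norm_smul,
      ContinuousLinearMap.norm_smulRight_apply, innerSL_apply_norm]
    simp only [norm_inv, norm_pow, Complex.norm_real, norm_norm]
    rw [show (‖a‖ ^ 2)⁻¹ * (‖a‖ * ‖b‖) = ‖b‖ / ‖a‖ by field_simp, div_lt_one hpos]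
    exact hlt
  · have h1 : M2L p q ((M2L p q).symm T) a = b := by
      rw [ContinuousLinearEquiv.apply_symm_apply]
      simp only [T, _root_.smul_apply, ContinuousLinearMap.smulRight_apply, innerSL_apply_apply,
        inner_self_eq_norm_sq_to_K, smul_smul]
      have h5 : (((‖a‖ : ℝ) : ℂ) ^ 2)⁻¹ * ((‖a‖ : ℝ) : ℂ) ^ 2 = 1 := by field_simp
      exact (congrArg (fun c : ℂ => c • b) h5).trans (one_smul _ _)
    rw [M2L_apply] at h1
    exact congrArg WithLp.ofLp h1

theorem cone_open (q p : ℕ) : IsOpen (genBallCone q p) := by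
  apply isOpen_lt <;> fun_prop

theorem extend_rows (N : ℕ) : ∀ (d r : ℕ) (v : Fin r → Fin N → ℂ), LinearIndependent ℂ v → r + d = N →
    ∃ w : Fin N → Fin N → ℂ, LinearIndependent ℂ w ∧ ∀ (i : Fin r) (a : Fin N), a.1 = i.1 → w a = v i := by
  intro d
  induction d with
  | zero =>
    intro r v hv h
    obtain rfl : r = N := by omega
    exact ⟨v, hv, fun i a h => by rw [Fin.ext h]⟩
  | succ d ih =>
    intro r v hv h
    obtain ⟨x, hx⟩ := exists_linearIndependent_snoc_of_lt_finrank hv (by rw [Module.finrank_fin_fun]; omega)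
    obtain ⟨w, hw, hwv⟩ := ih (r + 1) _ hx (by omega)
    refine ⟨w, hw, fun i a ha => ?_⟩
    rw [hwv i.castSucc a (by simpa using ha), Fin.snoc_castSucc]
end abs

/-- Moving a matrix `Z` so that it maps `x.1` to `x.2`. -/
noncomputable def moveZ {p q : ℕ} (A0 : Fin q → ℂ) (Z : Matrix (Fin p) (Fin q) ℂ)
    (x : (Fin q → ℂ) × (Fin p → ℂ)) : Matrix (Fin p) (Fin q) ℂ :=
  Z + (star A0 ⬝ᵥ x.1)⁻¹ • Matrix.vecMulVec (x.2 - Z *ᵥ x.1) (star A0)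

theorem moveZ_mulVec {p q : ℕ} (A0 : Fin q → ℂ) (Z : Matrix (Fin p) (Fin q) ℂ)
    (x : (Fin q → ℂ) × (Fin p → ℂ)) (h : star A0 ⬝ᵥ x.1 ≠ 0) : moveZ A0 Z x *ᵥ x.1 = x.2 := by
  unfold moveZ
  rw [Matrix.add_mulVec, Matrix.smul_mulVec, Matrix.vecMulVec_mulVec]
  ext i
  simp
  field_simp
  ring

theorem moveZ_self {p q : ℕ} (A0 : Fin q → ℂ) (Z : Matrix (Fin p) (Fin q) ℂ)
    (x : (Fin q → ℂ) × (Fin p → ℂ)) (h : Z *ᵥ x.1 = x.2) : moveZ A0 Z x = Z := by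
  unfold moveZ
  rw [h, sub_self]
  ext i j
  simp [Matrix.vecMulVec_apply]

theorem matrix_diff_iff {V : Type*} [NormedAddCommGroup V] [NormedSpace ℂ V] {m n : ℕ} {S : Set V}
    {F : V → Matrix (Fin m) (Fin n) ℂ} :
    DifferentiableOn ℂ F S ↔ ∀ i j, DifferentiableOn ℂ (fun x => F x i j) S := by
  constructor
  · intro h i j
    have h1 := (differentiableOn_pi (𝕜 := ℂ)).mp h i
    exact (differentiableOn_pi (𝕜 := ℂ)).mp h1 j
  · intro h
    exact (differentiableOn_pi (𝕜 := ℂ)).mpr fun i => (differentiableOn_pi (𝕜 := ℂ)).mpr fun j => h i j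

theorem moveZ_diff {p q : ℕ} (A0 : Fin q → ℂ) (Z : Matrix (Fin p) (Fin q) ℂ) :
    DifferentiableOn ℂ (moveZ A0 Z) {x | star A0 ⬝ᵥ x.1 ≠ 0} := by
  rw [matrix_diff_iff]
  intro i j
  have e : (fun x : (Fin q → ℂ) × (Fin p → ℂ) => moveZ A0 Z x i j) = fun x =>
      Z i j + (∑ k, star A0 k * x.1 k)⁻¹ * ((x.2 i - ∑ k, Z i k * x.1 k) * star A0 j) := by
    ext x
    simp [moveZ, Matrix.vecMulVec_apply, dotProduct, Matrix.mulVec]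
  rw [e]
  apply DifferentiableOn.const_add
  apply DifferentiableOn.mul
  · apply DifferentiableOn.inv
    · fun_prop
    · intro x hx; exact hx
  · fun_prop

theorem det_diff {V : Type*} [NormedAddCommGroup V] [NormedSpace ℂ V] {m : ℕ} {S : Set V}
    {F : V → Matrix (Fin m) (Fin m) ℂ} (h : ∀ i j, DifferentiableOn ℂ (fun x => F x i j) S) :
    DifferentiableOn ℂ (fun x => (F x).det) S := by
  simp only [Matrix.det_apply]
  apply DifferentiableOn.fun_sum
  intro σ _
  apply DifferentiableOn.const_smul
  have hprod : ∀ s : Finset (Fin m), DifferentiableOn ℂ (fun y => ∏ i ∈ s, F y (σ i) i) S := by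
    intro s
    induction s using Finset.induction_on with
    | empty => simpa using differentiableOn_const (1 : ℂ)
    | insert i s his ih =>
      simp only [Finset.prod_insert his]
      exact (h _ _).mul ih
  exact hprod _

theorem moduli {p q p' q' : ℕ} (hq : 0 < q) (hq'p : q' < p)
    (f : Matrix (Fin p) (Fin q) ℂ → Matrix (Fin p') (Fin q') ℂ)
    (hf : DifferentiableOn ℂ f (typeIDomain p q))
    (hfp : ProperOn f (typeIDomain p q) (typeIDomain p' q')) :
    ∃ U : Set ((Fin q → ℂ) × (Fin p → ℂ)),
      U.Nonempty ∧ IsOpen U ∧ IsConnected U ∧ U ⊆ genBallCone q p ∧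
      ∃ (g1 : (Fin q → ℂ) × (Fin p → ℂ) → (Fin q' → ℂ))
        (g2 : (Fin q → ℂ) × (Fin p → ℂ) → (Fin p' → ℂ)),
        DifferentiableOn ℂ g1 U ∧ DifferentiableOn ℂ g2 U ∧
        (∀ x ∈ U, (g1 x, g2 x) ∈ genBallCone q' p') ∧
        ∀ x ∈ U, ∀ Z ∈ typeIDomain p q, Z *ᵥ x.1 = x.2 → f Z *ᵥ g1 x = g2 x := by
  let P : ℕ → Prop := fun r => ∃ x ∈ genBallCone q p, ∃ Z0 ∈ typeIDomain p q, Z0 *ᵥ x.1 = x.2 ∧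
    ∃ (Z : Fin r → Matrix (Fin p) (Fin q) ℂ) (j : Fin r → Fin p'),
      (∀ i, Z i ∈ typeIDomain p q ∧ Z i *ᵥ x.1 = x.2) ∧
      LinearIndependent ℂ (fun i => f (Z i) (j i) - f Z0 (j i))
  have hP0 : P 0 := by
    have hx : ((Pi.single ⟨0, hq⟩ 1, 0) : (Fin q → ℂ) × (Fin p → ℂ)) ∈ genBallCone q p := by
      change ∑ j, ‖(0 : Fin p → ℂ) j‖ ^ 2 < ∑ i, ‖(Pi.single ⟨0, hq⟩ (1 : ℂ) : Fin q → ℂ) i‖ ^ 2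
      rw [Finset.sum_eq_single (⟨0, hq⟩ : Fin q)]
      · simp
      · intro b _ hb
        simp [hb]
      · simp
    obtain ⟨Z0, h1, h2⟩ := fiber_nonempty hx
    exact ⟨_, hx, Z0, h1, h2, fun i => i.elim0, fun i => i.elim0, fun i => i.elim0,
      linearIndependent_empty_type⟩
  have hPn : ¬ P q' := by
    rintro ⟨x, hx, Z0, hZ0, hZ0x, Z, j, hZ, hli⟩
    obtain ⟨C, hC, hCZ⟩ := core_mat hq'p f hf hfp x.1 (cone_ne hx) Z0 hZ0
    apply hC
    have hu := (Matrix.linearIndependent_rows_iff_isUnit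
      (A := Matrix.of fun i => f (Z i) (j i) - f Z0 (j i))).mp hli
    have h1 : (Matrix.of fun i => f (Z i) (j i) - f Z0 (j i)) *ᵥ C = 0 := by
      ext i
      have := congrFun (hCZ (Z i) (hZ i).1 (by rw [(hZ i).2, hZ0x])) (j i)
      change (f (Z i) (j i) - f Z0 (j i)) ⬝ᵥ C = 0
      rw [sub_dotProduct, sub_eq_zero]
      exact this
    have h2 := Matrix.mulVec_injective_of_isUnit hu
    apply h2
    rw [h1, Matrix.mulVec_zero]
  obtain ⟨r, hr, ⟨x0, hx0, Z0, hZ0, hZ0x, Z, j, hZ, hli⟩, hr1⟩ : ∃ k < q', P k ∧ ¬ P (k + 1) := by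
    by_contra hcon
    push Not at hcon
    apply hPn
    have : ∀ k, k ≤ q' → P k := by
      intro k
      induction k with
      | zero => exact fun _ => hP0
      | succ k ih => exact fun h => hcon k (by omega) (ih (by omega))
    exact this q' le_rfl
  obtain ⟨w, hw, hwv⟩ := extend_rows q' (q' - r) r _ hli (by omega)
  set A0 := x0.1 with hA0
  let N : (Fin q → ℂ) × (Fin p → ℂ) → Matrix (Fin q') (Fin q') ℂ := fun x => Matrix.of fun a =>
    if h : a.1 < r then f (moveZ A0 (Z ⟨a.1, h⟩) x) (j ⟨a.1, h⟩) - f (moveZ A0 Z0 x) (j ⟨a.1, h⟩)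
    else w a
  have hN0 : N x0 = Matrix.of w := by
    ext a b
    simp only [N, Matrix.of_apply]
    split_ifs with h
    · rw [moveZ_self A0 _ x0 (hZ _).2, moveZ_self A0 _ x0 hZ0x, hwv ⟨a.1, h⟩ a rfl]
    · rfl
  have hdet0 : (N x0).det ≠ 0 := by
    rw [hN0]
    have := (Matrix.linearIndependent_rows_iff_isUnit (A := Matrix.of w)).mp hw
    rw [Matrix.isUnit_iff_isUnit_det] at this
    exact this.ne_zero
  have hdot0 : star A0 ⬝ᵥ x0.1 ≠ 0 := by
    rw [← hA0, star_dot_self]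
    have h1 : ∑ j, ‖x0.2 j‖ ^ 2 < ∑ i, ‖x0.1 i‖ ^ 2 := hx0
    have : 0 ≤ ∑ j, ‖x0.2 j‖ ^ 2 := by positivity
    exact_mod_cast (this.trans_lt h1).ne'
  let V0 : Set ((Fin q → ℂ) × (Fin p → ℂ)) := {x | star A0 ⬝ᵥ x.1 ≠ 0}
  have hV0 : IsOpen V0 := by
    have : Continuous fun x : (Fin q → ℂ) × (Fin p → ℂ) => star A0 ⬝ᵥ x.1 := by
      simp only [dotProduct]; fun_prop
    exact isOpen_ne_fun this continuous_const
  have hmv : ∀ W : Matrix (Fin p) (Fin q) ℂ, ContinuousOn (moveZ A0 W) V0 := fun W =>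
    (moveZ_diff A0 W).continuousOn
  let V1 : Set ((Fin q → ℂ) × (Fin p → ℂ)) := (V0 ∩ moveZ A0 Z0 ⁻¹' typeIDomain p q) ∩
    ⋂ i, (V0 ∩ moveZ A0 (Z i) ⁻¹' typeIDomain p q)
  have hV1 : IsOpen V1 :=
    ((hmv Z0).isOpen_inter_preimage hV0 typeI_open).inter
      (isOpen_iInter_of_finite fun i => (hmv (Z i)).isOpen_inter_preimage hV0 typeI_open)
  have hx0V1 : x0 ∈ V1 := by
    refine ⟨⟨hdot0, ?_⟩, mem_iInter.mpr fun i => ⟨hdot0, ?_⟩⟩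
    · rw [mem_preimage, moveZ_self A0 _ x0 hZ0x]; exact hZ0
    · rw [mem_preimage, moveZ_self A0 _ x0 (hZ i).2]; exact (hZ i).1
  have hd0 : DifferentiableOn ℂ (fun x => f (moveZ A0 Z0 x)) V1 :=
    hf.comp ((moveZ_diff A0 Z0).mono fun x hx => hx.1.1) (fun x hx => hx.1.2)
  have hdi : ∀ i, DifferentiableOn ℂ (fun x => f (moveZ A0 (Z i) x)) V1 := fun i =>
    hf.comp ((moveZ_diff A0 (Z i)).mono fun x hx => hx.1.1) (fun x hx => (mem_iInter.mp hx.2 i).2)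
  have hNd : ∀ a b, DifferentiableOn ℂ (fun x => N x a b) V1 := by
    intro a b
    simp only [N, Matrix.of_apply]
    split_ifs with h
    · exact (matrix_diff_iff.mp (hdi ⟨a.1, h⟩) _ b).sub (matrix_diff_iff.mp hd0 _ b)
    · exact differentiableOn_const _
  let V2 : Set ((Fin q → ℂ) × (Fin p → ℂ)) := (V1 ∩ (fun x => (N x).det) ⁻¹' {0}ᶜ) ∩ genBallCone q p
  have hV2 : IsOpen V2 :=
    ((det_diff hNd).continuousOn.isOpen_inter_preimage hV1 isOpen_compl_singleton).inter (cone_open q p)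
  obtain ⟨ε, hε, hU⟩ := Metric.isOpen_iff.mp hV2 x0 ⟨⟨hx0V1, hdet0⟩, hx0⟩
  let a0 : Fin q' := ⟨r, hr⟩
  let g1 : (Fin q → ℂ) × (Fin p → ℂ) → (Fin q' → ℂ) := fun x => (N x).cramer (Pi.single a0 1)
  let g2 : (Fin q → ℂ) × (Fin p → ℂ) → (Fin p' → ℂ) := fun x => f (moveZ A0 Z0 x) *ᵥ g1 x
  have hg1 : DifferentiableOn ℂ g1 V1 := by
    rw [differentiableOn_pi]
    intro i
    simp only [g1, Matrix.cramer_apply]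
    apply det_diff
    intro a b
    by_cases hb : b = i
    · subst hb
      simp only [Matrix.updateCol_self]
      exact differentiableOn_const _
    · simp only [Matrix.updateCol_ne hb]
      exact hNd a b
  have hg2 : DifferentiableOn ℂ g2 V1 := by
    rw [differentiableOn_pi]
    intro i
    simp only [g2, Matrix.mulVec, dotProduct]
    apply DifferentiableOn.fun_sum
    intro k _
    exact (matrix_diff_iff.mp hd0 i k).mul (differentiableOn_pi.mp hg1 k)
  have hNg : ∀ x, N x *ᵥ g1 x = (N x).det • Pi.single a0 1 := fun x => Matrix.mulVec_cramer _ _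
  have hU1 : ball x0 ε ⊆ V1 := fun x hx => (hU hx).1.1
  refine ⟨ball x0 ε, ⟨x0, mem_ball_self hε⟩, isOpen_ball,
    ⟨⟨x0, mem_ball_self hε⟩, (convex_ball x0 ε).isPreconnected⟩, fun x hx => (hU hx).2, g1, g2,
    hg1.mono hU1, hg2.mono hU1, ?_, ?_⟩
  · intro x hx
    have hne : g1 x ≠ 0 := by
      intro h0
      have h1 := congrFun (hNg x) a0
      rw [h0, Matrix.mulVec_zero] at h1
      simp at h1
      exact (hU hx).1.2 h1.symm
    have h2 := hfp.1 (hU1 hx).1.2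
    exact (typeI_pointwise _).mp h2 _ hne
  · intro x hx W hW hWx
    have hdot : star A0 ⬝ᵥ x.1 ≠ 0 := (hU1 hx).1.1
    set Zx : Fin r → Matrix (Fin p) (Fin q) ℂ := fun i => moveZ A0 (Z i) x with hZx
    have hrow : ∀ i : Fin r, N x ⟨i.1, by omega⟩ = f (Zx i) (j i) - f (moveZ A0 Z0 x) (j i) := by
      intro i
      have hi : i.1 < r := i.2
      ext b
      simp [N, hi, hZx]
    have hlix : LinearIndependent ℂ (fun i => f (Zx i) (j i) - f (moveZ A0 Z0 x) (j i)) := by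
      have hu : IsUnit (N x) := by
        rw [Matrix.isUnit_iff_isUnit_det]
        exact isUnit_iff_ne_zero.mpr (hU hx).1.2
      have h1 := Matrix.linearIndependent_rows_iff_isUnit.mpr hu
      have h2 := h1.comp (fun i : Fin r => (⟨i.1, by omega⟩ : Fin q')) (by
        intro a b hab
        simpa [Fin.ext_iff] using hab)
      have e : (fun i => f (Zx i) (j i) - f (moveZ A0 Z0 x) (j i)) =
          (N x).row ∘ fun i : Fin r => (⟨i.1, by omega⟩ : Fin q') := by
        funext i
        exact (hrow i).symm
      rw [e]
      exact h2
    have hker : ∀ i : Fin r, (f (Zx i) (j i) - f (moveZ A0 Z0 x) (j i)) ⬝ᵥ g1 x = 0 := by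
      intro i
      rw [← hrow i]
      have h1 := congrFun (hNg x) ⟨i.1, by omega⟩
      have h2 : (⟨i.1, by omega⟩ : Fin q') ≠ a0 := by
        intro h; have := congrArg Fin.val h; simp [a0] at this; omega
      simp only [Pi.smul_apply, Pi.single_eq_of_ne h2, smul_zero] at h1
      exact h1
    ext k
    change f W k ⬝ᵥ g1 x = f (moveZ A0 Z0 x) k ⬝ᵥ g1 x
    rw [← sub_eq_zero, ← sub_dotProduct]
    have hspan : f W k - f (moveZ A0 Z0 x) k ∈
        Submodule.span ℂ (range fun i => f (Zx i) (j i) - f (moveZ A0 Z0 x) (j i)) := by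
      by_contra hns
      apply hr1
      refine ⟨x, (hU hx).2, moveZ A0 Z0 x, (hU1 hx).1.2, moveZ_mulVec A0 Z0 x hdot,
        Fin.snoc (α := fun _ => Matrix (Fin p) (Fin q) ℂ) Zx W, Fin.snoc (α := fun _ => Fin p') j k, ?_, ?_⟩
      · intro i
        refine Fin.lastCases ?_ (fun i => ?_) i
        · simp only [Fin.snoc_last]; exact ⟨hW, hWx⟩
        · simp only [Fin.snoc_castSucc]
          exact ⟨(mem_iInter.mp (hU1 hx).2 i).2, moveZ_mulVec A0 (Z i) x hdot⟩
      · have := linearIndependent_finSnoc.mpr ⟨hlix, hns⟩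
        have e : (fun i => f (Fin.snoc (α := fun _ => Matrix (Fin p) (Fin q) ℂ) Zx W i)
            (Fin.snoc (α := fun _ => Fin p') j k i) - f (moveZ A0 Z0 x)
            (Fin.snoc (α := fun _ => Fin p') j k i)) =
            Fin.snoc (α := fun _ => Fin q' → ℂ) (fun i => f (Zx i) (j i) - f (moveZ A0 Z0 x) (j i))
              (f W k - f (moveZ A0 Z0 x) k) := by
          funext i
          refine Fin.lastCases ?_ (fun i => ?_) i
          · simp only [Fin.snoc_last]
          · simp only [Fin.snoc_castSucc]
        rw [e]
        exact this
    generalize f W k - f (moveZ A0 Z0 x) k = y at hspan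
    induction hspan using Submodule.span_induction with
    | mem y hy => obtain ⟨i, rfl⟩ := hy; exact hker i
    | zero => simp
    | add a b _ _ ha hb => rw [add_dotProduct, ha, hb, add_zero]
    | smul c a _ ha => rw [smul_dotProduct, ha, smul_zero]
end helpers

/-- For a proper holomorphic map `f : D^I_{p,q} → D^I_{p',q'}` with `p ≥ q ≥ 2` and
`q' < p`, the transposed map `f^†` is fibral-image-preserving and admits a holomorphic
local moduli map defined on a nonempty connected open subset of the cone over
`D_{q,p}`. -/
theorem stmt_18 (p q p' q' : ℕ) (h0p' : 0 < p') (h0q' : 0 < q')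
    (h2q : 2 ≤ q) (hqp : q ≤ p) (hq'p : q' < p)
    (f : Matrix (Fin p) (Fin q) ℂ → Matrix (Fin p') (Fin q') ℂ)
    (hf : DifferentiableOn ℂ f (typeIDomain p q))
    (hfp : ProperOn f (typeIDomain p q) (typeIDomain p' q')) :
    (∀ x ∈ genBallCone q p, ∃ y ∈ genBallCone q' p',
      ∀ Z ∈ typeIDomain q p, x.1 ᵥ* Z = x.2 → y.1 ᵥ* (dagger f Z) = y.2) ∧
    ∃ U : Set ((Fin q → ℂ) × (Fin p → ℂ)),
      U.Nonempty ∧ IsOpen U ∧ IsConnected U ∧ U ⊆ genBallCone q p ∧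
      ∃ (g1 : (Fin q → ℂ) × (Fin p → ℂ) → (Fin q' → ℂ))
        (g2 : (Fin q → ℂ) × (Fin p → ℂ) → (Fin p' → ℂ)),
        DifferentiableOn ℂ g1 U ∧ DifferentiableOn ℂ g2 U ∧
        (∀ x ∈ U, (g1 x, g2 x) ∈ genBallCone q' p') ∧
        ∀ x ∈ U, ∀ Z ∈ typeIDomain q p, x.1 ᵥ* Z = x.2 →
          (g1 x) ᵥ* (dagger f Z) = g2 x := by
  constructor
  · intro x hx
    obtain ⟨Z0, hZ0, hZ0x⟩ := fiber_nonempty hx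
    obtain ⟨C, hC, hCZ⟩ := core_mat hq'p f hf hfp x.1 (cone_ne hx) Z0 hZ0
    refine ⟨(C, f Z0 *ᵥ C), (typeI_pointwise _).mp (hfp.1 hZ0) C hC, ?_⟩
    intro Z hZ hZx
    change C ᵥ* (f Zᵀ)ᵀ = f Z0 *ᵥ C
    rw [Matrix.vecMul_transpose]
    apply hCZ _ (typeI_transpose hZ)
    rw [Matrix.mulVec_transpose, hZx, hZ0x]
  · obtain ⟨U, h1, h2, h3, h4, g1, g2, h5, h6, h7, h8⟩ := moduli (by omega) hq'p f hf hfp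
    refine ⟨U, h1, h2, h3, h4, g1, g2, h5, h6, h7, ?_⟩
    intro x hx Z hZ hZx
    change g1 x ᵥ* (f Zᵀ)ᵀ = g2 x
    rw [Matrix.vecMul_transpose]
    apply h8 x hx _ (typeI_transpose hZ)
    rw [Matrix.mulVec_transpose, hZx]
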